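/- arXiv:2406.03167 — 7 statements merged into one kernel-verified Lean document; each statement's English description precedes it below -/
import Mathlib

section
/- Let F = (F^×, N_F) be a tract, Γ a linearly ordered abelian group, E a finite linearly ordered set, and 1 ≤ r ≤ |E|. Let P be a function from the r-subsets of E to F[Γ] that is not identically equal to the zero element ∞. Then P is a weak F[Γ]-Plücker vector (i.e. satisfies the Plücker relation 𝒫_{I;J} over F[Γ] for all (r−1)-subsets I and (r+1)-subsets J with |J∖I| = 3) if and only if, for every u ∈ Γ^E, the initial function P^u is a weak F-Plücker vector (i.e. P^u is not identically 0 and satisfies 𝒫_{I;J} over F for all such I, J with |J∖I| = 3). -/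
open scoped Classical

/-- A tract `F = (F^×, N_F)`: a multiplicative abelian group `α = F^×` together with a null set
of formal sums (multisets) of elements of `F^×`, satisfying (T1)-(T4). -/
structure Tract (α : Type*) [CommGroup α] where
  null : Set (Multiset α)
  zero_mem : (0 : Multiset α) ∈ null
  one_not_mem : ({1} : Multiset α) ∉ null
  existsUnique_minusOne : ∃! ε : α, ({1, ε} : Multiset α) ∈ null
  scale_mem : ∀ c : α, ∀ s ∈ null, Multiset.map (fun a => c * a) s ∈ null

/-- The distinguished element `-1` of a tract. -/
noncomputable def Tract.minusOne {α : Type*} [CommGroup α] (T : Tract α) : α :=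
  T.existsUnique_minusOne.choose

/-- Multiplication on `F ∪ {0}`, encoding the zero element as `none`. -/
def oMul {β : Type*} (m : β → β → β) : Option β → Option β → Option β
  | some a, some b => some (m a b)
  | _, _ => none

section Plucker

variable {α : Type*} [CommGroup α] {Γ : Type*} [AddCommGroup Γ] [LinearOrder Γ] [IsOrderedAddMonoid Γ]
  {E : Type*} [Fintype E] [LinearOrder E]

/-- `sign(j; I, J) = (-1)^ℓ`, where `ℓ` is the number of `j' ∈ J` with `j < j'` plus the
number of `i ∈ I` with `j < i`, as an element of the tract. -/
noncomputable def plSign (T : Tract α) (j : E) (I J : Finset E) : α :=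
  T.minusOne ^ ((J.filter fun j' => j < j').card + (I.filter fun i => j < i).card)

/-- Multiplication on the multiplicative group `F^× × Γ` of the tropical extension `F[Γ]`. -/
def extMul : α × Γ → α × Γ → α × Γ := fun p q => (p.1 * q.1, p.2 + q.2)

/-- Membership in the null set `N_{F[Γ]}` of the tropical extension: the formal sum of the
entries whose `Γ`-component is minimal lies in `N_F`. -/
def extNullMem (T : Tract α) (s : Multiset (α × Γ)) : Prop :=
  (Multiset.map Prod.fst (s.filter fun p => ∀ q ∈ s, p.2 ≤ q.2)) ∈ T.null

/-- The Plücker (incidence) relation `𝒫_{I;J}` over the tropical extension `F[Γ]` for functions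
`P, Q` on subsets of `E` with values in `F[Γ] = (F^× × Γ) ∪ {∞}`: the formal sum of the nonzero
terms `sign(j;I,J)·P(I∪{j})·Q(J∖{j})` lies in `N_{F[Γ]}`. -/
def PluckerRelExt (T : Tract α) (P Q : Finset E → Option (α × Γ)) (I J : Finset E) : Prop :=
  extNullMem T ((Multiset.map (fun j =>
    oMul extMul (some (plSign T j I J, (0 : Γ)))
      (oMul extMul (P (insert j I)) (Q (J.erase j)))) (J \ I).val).filterMap id)

/-- The Plücker (incidence) relation `𝒫_{I;J}` over the tract `F` for functions with values in
`F = F^× ∪ {0}`. -/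
def PluckerRelF (T : Tract α) (P Q : Finset E → Option α) (I J : Finset E) : Prop :=
  ((Multiset.map (fun j =>
    oMul (· * ·) (some (plSign T j I J))
      (oMul (· * ·) (P (insert j I)) (Q (J.erase j)))) (J \ I).val).filterMap id) ∈ T.null

/-- `|x| ∈ Γ ∪ {∞}` of an element of `F[Γ]`. -/
def modu (x : Option (α × Γ)) : WithTop Γ := x.elim ⊤ fun p => (p.2 : WithTop Γ)

/-- Subtraction of a group element from `Γ ∪ {∞}`, with `∞ - g = ∞`. -/
def wsub (x : WithTop Γ) (g : Γ) : WithTop Γ := x.map fun γ => γ - g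

/-- The initial function `P^u` of `P : binom(E, r) → F[Γ]` with respect to `u ∈ Γ^E`:
`P^u(B) = θ(P(B))` if `|P(B)| - ∑_{i∈B} u_i` is minimal among all `r`-subsets, else `0`. -/
noncomputable def initialFn (P : Finset E → Option (α × Γ)) (r : ℕ) (u : E → Γ)
    (B : Finset E) : Option α :=
  if ∀ B' : Finset E, B'.card = r →
      wsub (modu (P B)) (∑ i ∈ B, u i) ≤ wsub (modu (P B')) (∑ i ∈ B', u i)
  then (P B).map Prod.fst else none

end Plucker

section Helpers

set_option linter.unusedSectionVars false

variable {α : Type*} [CommGroup α] {Γ : Type*} [AddCommGroup Γ] [LinearOrder Γ] [IsOrderedAddMonoid Γ]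
  {E : Type*} [Fintype E] [LinearOrder E]

lemma multiset_filterMap_congr {β γ : Type*} (f g : β → Option γ) (s : Multiset β)
    (h : ∀ x ∈ s, f x = g x) : Multiset.filterMap f s = Multiset.filterMap g s := by
  induction s using Multiset.induction_on with
  | empty => rfl
  | cons a s ih =>
    have h1 := h a (Multiset.mem_cons_self a s)
    have h2 := ih fun x hx => h x (Multiset.mem_cons_of_mem hx)
    rcases hg : g a with _ | b
    · rw [Multiset.filterMap_cons_none _ _ hg, Multiset.filterMap_cons_none _ _ (h1.trans hg), h2]
    · rw [Multiset.filterMap_cons_some _ _ _ hg, Multiset.filterMap_cons_some _ _ _ (h1.trans hg), h2]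

lemma initialFn_none (P : Finset E → Option (α × Γ)) (r : ℕ) (u : E → Γ) (B : Finset E)
    (h : P B = none) : initialFn P r u B = none := by
  unfold initialFn
  rw [h]; simp

lemma initialFn_some (P : Finset E → Option (α × Γ)) (r : ℕ) (u : E → Γ) (m : Γ)
    (hm : ∀ B : Finset E, B.card = r → ∀ p, P B = some p → m + ∑ i ∈ B, u i ≤ p.2)
    (ht : ∃ B : Finset E, B.card = r ∧ ∃ p, P B = some p ∧ m + ∑ i ∈ B, u i = p.2)
    (B : Finset E) (hB : B.card = r) (p : α × Γ) (h : P B = some p) :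
    initialFn P r u B = if m + ∑ i ∈ B, u i = p.2 then some p.1 else none := by
  unfold initialFn
  obtain ⟨B0, hB0, p0, hp0, ht0⟩ := ht
  by_cases hc : m + ∑ i ∈ B, u i = p.2
  · rw [if_pos hc, if_pos, h]
    · rfl
    · intro B' hB'
      rw [h]
      rcases hq : P B' with _ | q
      · simp [modu, wsub]
      · have := hm B' hB' q hq
        have h1 : p.2 - ∑ i ∈ B, u i ≤ q.2 - ∑ i ∈ B', u i := by
          rw [← hc]; simpa [le_sub_iff_add_le] using this
        simpa [modu, wsub] using (WithTop.coe_le_coe.mpr h1)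
  · rw [if_neg hc, if_neg]
    intro hall
    apply hc
    have h2 := hall B0 hB0
    rw [h, hp0] at h2
    have h1 : p.2 - ∑ i ∈ B, u i ≤ p0.2 - ∑ i ∈ B0, u i := by
      have : ((p.2 - ∑ i ∈ B, u i : Γ) : WithTop Γ) ≤ ((p0.2 - ∑ i ∈ B0, u i : Γ) : WithTop Γ) := h2
      exact WithTop.coe_le_coe.mp this
    apply le_antisymm (hm B hB p h)
    rw [← ht0] at h1
    simpa [sub_le_iff_le_add] using h1

lemma pluckerRelF_iff (T : Tract α) (P : Finset E → Option (α × Γ)) (r : ℕ) (u : E → Γ) (m : Γ)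
    (hm : ∀ B : Finset E, B.card = r → ∀ p, P B = some p → m + ∑ i ∈ B, u i ≤ p.2)
    (ht : ∃ B : Finset E, B.card = r ∧ ∃ p, P B = some p ∧ m + ∑ i ∈ B, u i = p.2)
    (I J : Finset E) (hI : I.card + 1 = r) (hJ : J.card = r + 1) :
    (PluckerRelF T (initialFn P r u) (initialFn P r u) I J ↔
    Multiset.map Prod.fst ((Multiset.filterMap id (Multiset.map (fun j =>
    oMul extMul (some (plSign T j I J, (0 : Γ)))
      (oMul extMul (P (insert j I)) (P (J.erase j)))) (J \ I).val)).filter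
        fun p => p.2 = m + m + (∑ i ∈ I, u i + ∑ i ∈ J, u i)) ∈ T.null) ∧
    ∀ p ∈ (Multiset.filterMap id (Multiset.map (fun j =>
    oMul extMul (some (plSign T j I J, (0 : Γ)))
      (oMul extMul (P (insert j I)) (P (J.erase j)))) (J \ I).val)),
        m + m + (∑ i ∈ I, u i + ∑ i ∈ J, u i) ≤ p.2 := by
  have hcard : ∀ j ∈ J \ I, (insert j I).card = r ∧ (J.erase j).card = r := by
    intro j hj
    rw [Finset.mem_sdiff] at hj
    rw [Finset.card_insert_of_notMem hj.2, Finset.card_erase_of_mem hj.1]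
    omega
  have hsum : ∀ j ∈ J \ I, m + m + (∑ i ∈ I, u i + ∑ i ∈ J, u i)
      = (m + ∑ i ∈ insert j I, u i) + (m + ∑ i ∈ J.erase j, u i) := by
    intro j hj
    rw [Finset.mem_sdiff] at hj
    rw [Finset.sum_insert hj.2, ← Finset.add_sum_erase J u hj.1]
    abel
  constructor
  · unfold PluckerRelF
    apply iff_of_eq
    congr 1
    rw [Multiset.filterMap_map, Multiset.filterMap_map, ← Multiset.filterMap_eq_filter,
      Multiset.filterMap_filterMap, Multiset.map_filterMap]
    apply multiset_filterMap_congr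
    intro j hj
    have hj : j ∈ J \ I := hj
    obtain ⟨h1, h2⟩ := hcard j hj
    rw [hsum j hj]
    simp only [Function.comp, id]
    rcases hp : P (insert j I) with _ | p
    · simp [initialFn_none P r u _ hp, oMul]
    · rcases hq : P (J.erase j) with _ | q
      · simp [initialFn_none P r u _ hq, oMul]
      · rw [initialFn_some P r u m hm ht _ h1 p hp, initialFn_some P r u m hm ht _ h2 q hq]
        have b1 := hm _ h1 p hp
        have b2 := hm _ h2 q hq
        by_cases c1 : m + ∑ i ∈ insert j I, u i = p.2
        · by_cases c2 : m + ∑ i ∈ J.erase j, u i = q.2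
          · simp [c1, c2, oMul, extMul, Option.guard]
          · have : ¬ q.2 = m + ∑ i ∈ J.erase j, u i := fun h => c2 h.symm
            simp [c1, c2, oMul, extMul, Option.guard, this]
        · have : p.2 + q.2 ≠ m + ∑ i ∈ insert j I, u i + (m + ∑ i ∈ J.erase j, u i) :=
            (add_lt_add_of_lt_of_le (lt_of_le_of_ne b1 c1) b2).ne'
          simp [c1, oMul, extMul, Option.guard, this]
  · intro t ht
    rw [Multiset.filterMap_map, Multiset.mem_filterMap] at ht
    obtain ⟨j, hj, hjt⟩ := ht
    have hj : j ∈ J \ I := hj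
    obtain ⟨h1, h2⟩ := hcard j hj
    rw [hsum j hj]
    simp only [Function.comp, id] at hjt
    rcases hp : P (insert j I) with _ | p
    · simp [hp, oMul] at hjt
    · rcases hq : P (J.erase j) with _ | q
      · simp [hq, oMul] at hjt
      · simp only [hp, hq, oMul, extMul, Option.some.injEq] at hjt
        subst hjt
        simpa using add_le_add (hm _ h1 p hp) (hm _ h2 q hq)

lemma exists_split_le (k : Γ) (p q : WithTop Γ) (h : (k : WithTop Γ) ≤ p + q) :
    ∃ x : Γ, (x : WithTop Γ) ≤ p ∧ ((k - x : Γ) : WithTop Γ) ≤ q := by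
  induction p using WithTop.recTopCoe with
  | top =>
    induction q using WithTop.recTopCoe with
    | top => exact ⟨0, le_top, le_top⟩
    | coe q => exact ⟨k - q, le_top, by simp⟩
  | coe p =>
    refine ⟨p, le_rfl, ?_⟩
    induction q using WithTop.recTopCoe with
    | top => exact le_top
    | coe q =>
      rw [← WithTop.coe_add, WithTop.coe_le_coe] at h
      rw [WithTop.coe_le_coe, sub_le_iff_le_add, add_comm]
      exact h

lemma exists_weight (f : Finset E → WithTop Γ) (S : Finset E) (a b c d : E)
    (hab : a ≠ b) (hac : a ≠ c) (had : a ≠ d) (hbc : b ≠ c) (hbd : b ≠ d) (hcd : c ≠ d)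
    (ha : a ∉ S) (hb : b ∉ S) (hc : c ∉ S) (hd : d ∉ S) (g h : Γ)
    (hg : f (S ∪ {a, b}) = g) (hh : f (S ∪ {c, d}) = h)
    (h1 : ((g + h : Γ) : WithTop Γ) ≤ f (S ∪ {a, c}) + f (S ∪ {b, d}))
    (h2 : ((g + h : Γ) : WithTop Γ) ≤ f (S ∪ {a, d}) + f (S ∪ {b, c})) :
    ∃ (u : E → Γ) (m : Γ),
      (∀ B : Finset E, B.card = S.card + 2 → ((m + ∑ i ∈ B, u i : Γ) : WithTop Γ) ≤ f B) ∧
      m + ∑ i ∈ S ∪ {a, b}, u i = g ∧ m + ∑ i ∈ S ∪ {c, d}, u i = h := by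
  obtain ⟨x, hx1, hx2⟩ := exists_split_le _ _ _ h1
  obtain ⟨z, hz1, hz2⟩ := exists_split_le _ _ _ h2
  obtain ⟨w, hw⟩ : ∃ w : E → Γ, w = fun i => if i = a then z - h else if i = b then g - x else
    if i = c then 0 else if i = d then h - (x - (z - h)) else 0 := ⟨_, rfl⟩
  have wa : w a = z - h := by simp [hw]
  have wb : w b = g - x := by simp [hw, hab.symm]
  have wc : w c = 0 := by simp [hw, hac.symm, hbc.symm]
  have wd : w d = h - (x - (z - h)) := by simp [hw, had.symm, hbd.symm, hcd.symm]
  have wS : ∀ i ∈ S, w i = 0 := by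
    intro i hi
    have e1 : i ≠ a := fun e => ha (e ▸ hi)
    have e2 : i ≠ b := fun e => hb (e ▸ hi)
    have e3 : i ≠ c := fun e => hc (e ▸ hi)
    have e4 : i ≠ d := fun e => hd (e ▸ hi)
    simp [hw, e1, e2, e4]
  clear hw
  obtain ⟨D, hD⟩ : ∃ D : Finset E, D = {a, b, c, d} := ⟨_, rfl⟩
  obtain ⟨M, hM⟩ := Finset.exists_le (insert 0 ((Finset.univ : Finset (Finset E)).image
    fun B => (x - (z - h)) + ∑ i ∈ B, w i - (f B).untopD 0))
  have hM0 : 0 ≤ M := hM 0 (Finset.mem_insert_self _ _)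
  have hMB : ∀ B : Finset E, (x - (z - h)) + ∑ i ∈ B, w i - (f B).untopD 0 ≤ M := fun B =>
    hM _ (Finset.mem_insert_of_mem (Finset.mem_image_of_mem _ (Finset.mem_univ B)))
  obtain ⟨e, he⟩ : ∃ e : E → ℤ, e = fun i => (if i ∈ S then 1 else 0) - if i ∈ S ∪ D then 0 else 1 :=
    ⟨_, rfl⟩
  have hesum : ∀ B : Finset E, ∑ i ∈ B, e i = ((B ∩ S).card : ℤ) - ((B \ (S ∪ D)).card : ℤ) := by
    intro B
    rw [he, Finset.sum_sub_distrib]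
    congr 1
    · rw [Finset.sum_ite_mem]; simp
    · rw [Finset.sdiff_eq_filter, Finset.card_filter]
      push_cast
      apply Finset.sum_congr rfl
      intro i _
      by_cases hi : i ∈ S ∪ D <;> simp only [hi, if_true, if_false, not_true, not_false_eq_true]
  have husum : ∀ B : Finset E, ∑ i ∈ B, (w i + e i • M) = ∑ i ∈ B, w i + (∑ i ∈ B, e i) • M := by
    intro B
    rw [Finset.sum_add_distrib, Finset.sum_smul]
  have hpair : ∀ p q : E, p ≠ q → p ∉ S → q ∉ S → p ∈ D → q ∈ D →
      (x - (z - h) - (S.card : ℤ) • M) + ∑ i ∈ S ∪ {p, q}, (w i + e i • M)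
        = x - (z - h) + (w p + w q) := by
    intro p q hpq hp hq hpD hqD
    rw [husum, hesum]
    have i1 : (S ∪ {p, q}) ∩ S = S := by
      apply Finset.inter_eq_right.mpr Finset.subset_union_left
    have i2 : (S ∪ {p, q}) \ (S ∪ D) = ∅ := by
      rw [Finset.sdiff_eq_empty_iff_subset]
      apply Finset.union_subset_union_right
      intro t ht
      simp only [Finset.mem_insert, Finset.mem_singleton] at ht
      rcases ht with rfl | rfl <;> assumption
    have i3 : ∑ i ∈ S ∪ {p, q}, w i = w p + w q := by
      rw [Finset.sum_union, Finset.sum_eq_zero wS, Finset.sum_pair hpq, zero_add]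
      simp [hp, hq]
    rw [i1, i2, i3]
    simp
  have aD : a ∈ D := by simp [hD]
  have bD : b ∈ D := by simp [hD]
  have cD : c ∈ D := by simp [hD]
  have dD : d ∈ D := by simp [hD]
  refine ⟨fun i => w i + e i • M, x - (z - h) - (S.card : ℤ) • M, ?_, ?_, ?_⟩
  · intro B hB
    by_cases hn : ∑ i ∈ B, e i = (S.card : ℤ)
    · have hle : (B ∩ S).card ≤ S.card := Finset.card_le_card Finset.inter_subset_right
      rw [hesum] at hn
      have k1 : S ⊆ B := by
        have : B ∩ S = S := Finset.eq_of_subset_of_card_le Finset.inter_subset_right (by omega)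
        exact Finset.inter_eq_right.mp this
      have k2 : B ⊆ S ∪ D := by
        rw [← Finset.sdiff_eq_empty_iff_subset, ← Finset.card_eq_zero]; omega
      have k3 : (B \ S).card = 2 := by
        rw [Finset.card_sdiff_of_subset k1]; omega
      obtain ⟨p, q, hpq, hBS⟩ := Finset.card_eq_two.mp k3
      have hBeq : B = S ∪ {p, q} := by rw [← hBS, Finset.union_sdiff_of_subset k1]
      have hp : p ∈ B \ S := by rw [hBS]; simp
      have hq : q ∈ B \ S := by rw [hBS]; simp
      rw [Finset.mem_sdiff] at hp hq
      have hpD : p ∈ D := (Finset.mem_union.mp (k2 hp.1)).resolve_left hp.2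
      have hqD : q ∈ D := (Finset.mem_union.mp (k2 hq.1)).resolve_left hq.2
      rw [hBeq, hpair p q hpq hp.2 hq.2 hpD hqD]
      have Lab : ((x - (z - h) + (w a + w b) : Γ) : WithTop Γ) ≤ f (S ∪ {a, b}) := by
        rw [hg, wa, wb, WithTop.coe_le_coe]; apply le_of_eq; abel
      have Lcd : ((x - (z - h) + (w c + w d) : Γ) : WithTop Γ) ≤ f (S ∪ {c, d}) := by
        rw [hh, wc, wd, WithTop.coe_le_coe]; apply le_of_eq; abel
      have Lac : ((x - (z - h) + (w a + w c) : Γ) : WithTop Γ) ≤ f (S ∪ {a, c}) := by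
        refine le_trans (le_of_eq ?_) hx1
        rw [wa, wc]; congr 1; abel
      have Lbd : ((x - (z - h) + (w b + w d) : Γ) : WithTop Γ) ≤ f (S ∪ {b, d}) := by
        refine le_trans (le_of_eq ?_) hx2
        rw [wb, wd]; congr 1; abel
      have Lad : ((x - (z - h) + (w a + w d) : Γ) : WithTop Γ) ≤ f (S ∪ {a, d}) := by
        refine le_trans (le_of_eq ?_) hz1
        rw [wa, wd]; congr 1; abel
      have Lbc : ((x - (z - h) + (w b + w c) : Γ) : WithTop Γ) ≤ f (S ∪ {b, c}) := by
        refine le_trans (le_of_eq ?_) hz2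
        rw [wb, wc]; congr 1; abel
      rw [hD] at hpD hqD
      simp only [Finset.mem_insert, Finset.mem_singleton] at hpD hqD
      rcases hpD with rfl | rfl | rfl | rfl <;> rcases hqD with rfl | rfl | rfl | rfl <;>
        first
        | exact absurd rfl hpq
        | assumption
        | (rw [Finset.pair_comm, add_comm (w _) (w _)]; assumption)
    · have hle : (B ∩ S).card ≤ S.card := Finset.card_le_card Finset.inter_subset_right
      have hlt : ∑ i ∈ B, e i ≤ (S.card : ℤ) - 1 := by
        rw [hesum] at hn ⊢; omega
      rw [husum]
      have := hMB B
      have h3 := zsmul_le_zsmul_left hM0 hlt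
      rw [sub_zsmul, one_zsmul, ← sub_eq_add_neg] at h3
      rcases hf : f B with _ | y
      · exact le_top
      · rw [hf] at this
        have this : x - (z - h) + ∑ i ∈ B, w i - y ≤ M := this
        apply WithTop.coe_le_coe.mpr
        have h4 : x - (z - h) + ∑ i ∈ B, w i ≤ M + y := sub_le_iff_le_add.mp this
        calc x - (z - h) - (S.card : ℤ) • M + (∑ i ∈ B, w i + (∑ i ∈ B, e i) • M)
            = (x - (z - h) + ∑ i ∈ B, w i) + (∑ i ∈ B, e i) • M - (S.card : ℤ) • M := by abel
          _ ≤ (M + y) + ((S.card : ℤ) • M - M) - (S.card : ℤ) • M := by gcongr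
          _ = y := by abel
  · rw [hpair a b hab ha hb aD bD, wa, wb]; abel
  · rw [hpair c d hcd hc hd cD dD, wc, wd]; abel

lemma exists_min (P : Finset E → Option (α × Γ)) (r : ℕ) (u : E → Γ)
    (hP : ∃ B : Finset E, B.card = r ∧ P B ≠ none) :
    ∃ m : Γ, (∀ B : Finset E, B.card = r → ∀ p, P B = some p → m + ∑ i ∈ B, u i ≤ p.2) ∧
    (∃ B : Finset E, B.card = r ∧ ∃ p, P B = some p ∧ m + ∑ i ∈ B, u i = p.2) := by
  obtain ⟨B, hB, hPB⟩ := hP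
  obtain ⟨B0, hB0, hmin⟩ := Finset.exists_min_image
    ((Finset.univ : Finset (Finset E)).filter fun B => B.card = r ∧ P B ≠ none)
    (fun B => ((P B).elim 0 Prod.snd) - ∑ i ∈ B, u i) ⟨B, by simp [hB, hPB]⟩
  simp only [Finset.mem_filter, Finset.mem_univ, true_and] at hB0 hmin
  obtain ⟨p0, hp0⟩ := Option.ne_none_iff_exists'.mp hB0.2
  refine ⟨p0.2 - ∑ i ∈ B0, u i, ?_, B0, hB0.1, p0, hp0, by abel⟩
  intro B' hB' p hp
  have := hmin B' ⟨hB', by simp [hp]⟩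
  rw [hp, hp0] at this
  exact le_sub_iff_add_le.mp this

lemma insert_struct (I J : Finset E) (c d : E) (Hd : ∀ x, (x ∈ I ∧ x ∉ J) ↔ x = d) (hc : c ∈ J) :
    insert c I = (I ∩ J) ∪ {c, d} := by
  ext x
  have := Hd x
  simp only [Finset.mem_insert, Finset.mem_union, Finset.mem_inter, Finset.mem_singleton]
  tauto

lemma erase_struct (I J : Finset E) (a b c : E) (hab : a ≠ b) (hc : c ∈ J) (hcI : c ∉ I)
    (Hab : ∀ x, (x ≠ c ∧ x ∈ J ∧ x ∉ I) ↔ (x = a ∨ x = b)) :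
    J.erase c = (I ∩ J) ∪ {a, b} ∧ J.erase a = (I ∩ J) ∪ {b, c} ∧
      J.erase b = (I ∩ J) ∪ {a, c} := by
  have Ha := (Hab a).mpr (Or.inl rfl)
  have Hb := (Hab b).mpr (Or.inr rfl)
  refine ⟨?_, ?_, ?_⟩ <;>
  · ext x
    have := Hab x
    simp only [Finset.mem_erase, Finset.mem_union, Finset.mem_inter, Finset.mem_insert,
      Finset.mem_singleton]
    by_cases xa : x = a
    · subst xa; tauto
    by_cases xb : x = b
    · subst xb; tauto
    by_cases xc : x = c
    · subst xc; tauto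
    tauto

lemma modu_coe_le (P : Finset E → Option (α × Γ)) (B : Finset E) (x : Γ) (p : α × Γ)
    (hp : P B = some p) (h : (x : WithTop Γ) ≤ modu (P B)) : x ≤ p.2 := by
  rw [hp] at h
  exact WithTop.coe_le_coe.mp h

end Helpers

/-- A function `P` on the `r`-subsets of `E` with values in `F[Γ]`, not
identically `∞`, is a weak `F[Γ]`-Plücker vector iff every initial function `P^u`, `u ∈ Γ^E`,
is a weak `F`-Plücker vector. -/
theorem weak_pluckerVector_iff_forall_initial
    {α : Type*} [CommGroup α] {Γ : Type*} [AddCommGroup Γ] [LinearOrder Γ] [IsOrderedAddMonoid Γ]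
    {E : Type*} [Fintype E] [LinearOrder E]
    (T : Tract α) (r : ℕ) (hr1 : 1 ≤ r) (hr2 : r ≤ Fintype.card E)
    (P : Finset E → Option (α × Γ))
    (hP : ∃ B : Finset E, B.card = r ∧ P B ≠ none) :
    (∀ I J : Finset E, I.card + 1 = r → J.card = r + 1 → (J \ I).card = 3 →
        PluckerRelExt T P P I J) ↔
      ∀ u : E → Γ,
        (∃ B : Finset E, B.card = r ∧ initialFn P r u B ≠ none) ∧
        ∀ I J : Finset E, I.card + 1 = r → J.card = r + 1 → (J \ I).card = 3 →
          PluckerRelF T (initialFn P r u) (initialFn P r u) I J := by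
  constructor
  · intro H u
    obtain ⟨m, hm, ht⟩ := exists_min P r u hP
    constructor
    · obtain ⟨B, hB, p, hp, he⟩ := ht
      refine ⟨B, hB, ?_⟩
      rw [initialFn_some P r u m hm ⟨B, hB, p, hp, he⟩ B hB p hp, if_pos he]
      simp
    · intro I J hI hJ hIJ
      obtain ⟨h1, h2⟩ := pluckerRelF_iff T P r u m hm ht I J hI hJ
      rw [h1]
      have h3 := H I J hI hJ hIJ
      unfold PluckerRelExt extNullMem at h3
      generalize Multiset.filterMap id _ = s at h2 h3 ⊢
      by_cases hs : ∃ p ∈ s, p.2 = m + m + (∑ i ∈ I, u i + ∑ i ∈ J, u i)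
      · obtain ⟨p, hp, hpe⟩ := hs
        convert h3 using 3
        rename_i q hq
        constructor
        · intro hqe t ht'
          rw [hqe]; exact h2 t ht'
        · intro hqe
          exact le_antisymm (hpe ▸ hqe p hp) (h2 q hq)
      · push Not at hs
        rw [Multiset.filter_eq_nil.mpr hs]
        exact T.zero_mem
  · intro H I J hI hJ hIJ
    unfold PluckerRelExt extNullMem
    by_cases hs : (Multiset.filterMap id (Multiset.map (fun j =>
        oMul extMul (some (plSign T j I J, (0 : Γ)))
          (oMul extMul (P (insert j I)) (P (J.erase j)))) (J \ I).val)) = 0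
    · rw [hs]
      exact T.zero_mem
    obtain ⟨t, ht, htmin⟩ : ∃ t ∈ (Multiset.filterMap id (Multiset.map (fun j =>
        oMul extMul (some (plSign T j I J, (0 : Γ)))
          (oMul extMul (P (insert j I)) (P (J.erase j)))) (J \ I).val)),
          ∀ q ∈ (Multiset.filterMap id (Multiset.map (fun j =>
        oMul extMul (some (plSign T j I J, (0 : Γ)))
          (oMul extMul (P (insert j I)) (P (J.erase j)))) (J \ I).val)), t.2 ≤ q.2 := by
      generalize Multiset.filterMap id _ = s at hs ⊢
      obtain ⟨t0, ht0⟩ := Multiset.exists_mem_of_ne_zero hs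
      obtain ⟨t, ht, hm⟩ := Finset.exists_min_image s.toFinset Prod.snd ⟨t0, by simpa using ht0⟩
      exact ⟨t, by simpa using ht, fun q hq => hm q (by simpa using hq)⟩
    have htm := ht
    rw [Multiset.filterMap_map, Multiset.mem_filterMap] at ht
    obtain ⟨c, hc, hct⟩ := ht
    have hc : c ∈ J \ I := hc
    simp only [Function.comp, id] at hct
    rcases hp : P (insert c I) with _ | p
    · simp [hp, oMul] at hct
    rcases hq : P (J.erase c) with _ | q
    · simp [hq, oMul] at hct
    simp only [hp, hq, oMul, extMul, Option.some.injEq, zero_add] at hct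
    have htmin' : ∀ j ∈ J \ I, ((q.2 + p.2 : Γ) : WithTop Γ) ≤
        modu (P (insert j I)) + modu (P (J.erase j)) := by
      intro j hj
      rcases hp' : P (insert j I) with _ | p'
      · simp [modu]
      rcases hq' : P (J.erase j) with _ | q'
      · simp [modu]
      have := htmin (plSign T j I J * (p'.1 * q'.1), 0 + (p'.2 + q'.2)) (by
        rw [Multiset.filterMap_map, Multiset.mem_filterMap]
        exact ⟨j, hj, by simp [hp', hq', oMul, extMul]⟩)
      rw [← hct] at this
      simp only [zero_add] at this
      rw [add_comm p.2] at this
      exact WithTop.coe_le_coe.mpr this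
    -- combinatorics of the sets
    have hcardIJ : (I \ J).card = 1 := by
      have e1 := Finset.card_sdiff_add_card_inter I J
      have e2 := Finset.card_sdiff_add_card_inter J I
      rw [Finset.inter_comm] at e2
      omega
    obtain ⟨d, hd⟩ := Finset.card_eq_one.mp hcardIJ
    have hcard2 : ((J \ I).erase c).card = 2 := by
      rw [Finset.card_erase_of_mem hc]; omega
    obtain ⟨a, b, hab, habeq⟩ := Finset.card_eq_two.mp hcard2
    have Hab : ∀ x, (x ≠ c ∧ x ∈ J ∧ x ∉ I) ↔ (x = a ∨ x = b) := by
      intro x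
      have := Finset.ext_iff.mp habeq x
      simpa using this
    have Hd : ∀ x, (x ∈ I ∧ x ∉ J) ↔ x = d := by
      intro x
      have := Finset.ext_iff.mp hd x
      simpa using this
    have Ha := (Hab a).mpr (Or.inl rfl)
    have Hb := (Hab b).mpr (Or.inr rfl)
    have Hdd := (Hd d).mpr rfl
    rw [Finset.mem_sdiff] at hc
    have had : a ≠ d := fun e => Hdd.2 (e ▸ Ha.2.1)
    have hbd : b ≠ d := fun e => Hdd.2 (e ▸ Hb.2.1)
    have hcd : c ≠ d := fun e => Hdd.2 (e ▸ hc.1)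
    have sc1 := insert_struct I J c d Hd hc.1
    have sa1 := insert_struct I J a d Hd Ha.2.1
    have sb1 := insert_struct I J b d Hd Hb.2.1
    obtain ⟨sc2, sa2, sb2⟩ := erase_struct I J a b c hab hc.1 hc.2 Hab
    have hScard : (I ∩ J).card + 2 = r := by
      have e1 := Finset.card_sdiff_add_card_inter I J
      omega
    obtain ⟨u, m, hum, hu1, hu2⟩ := exists_weight (fun B => modu (P B)) (I ∩ J) a b c d hab Ha.1 had
      Hb.1 hbd hcd (by simp [Ha.2.2]) (by simp [Hb.2.2]) (by simp [hc.2]) (by simp [Hdd.2])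
      q.2 p.2 (by simp only [← sc2, hq]; rfl) (by simp only [← sc1, hp]; rfl)
      (by
        simp only [← sb1, ← sb2]
        rw [add_comm (modu _)]
        exact htmin' b (by simp [Hb.2]))
      (by
        simp only [← sa1, ← sa2]
        exact htmin' a (by simp [Ha.2]))
    rw [← sc2] at hu1
    rw [← sc1] at hu2
    have hm : ∀ B : Finset E, B.card = r → ∀ p, P B = some p → m + ∑ i ∈ B, u i ≤ p.2 := by
      intro B hB p' hp'
      exact modu_coe_le P B _ p' hp' (hum B (by omega))
    have htt : ∃ B : Finset E, B.card = r ∧ ∃ p, P B = some p ∧ m + ∑ i ∈ B, u i = p.2 :=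
      ⟨insert c I, by rw [Finset.card_insert_of_notMem hc.2]; exact hI, p, hp, hu2⟩
    obtain ⟨h1, h2⟩ := pluckerRelF_iff T P r u m hm htt I J hI hJ
    have h3 := h1.mp ((H u).2 I J hI hJ hIJ)
    have hte : t.2 = m + m + (∑ i ∈ I, u i + ∑ i ∈ J, u i) := by
      rw [← hct]
      simp only
      rw [← hu1, ← hu2, Finset.sum_insert hc.2, ← Finset.add_sum_erase J u hc.1]
      abel
    clear h1
    generalize Multiset.filterMap id _ = s at htm htmin h2 h3 ⊢
    convert h3 using 3
    rename_i q' hq'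
    constructor
    · intro hall
      exact le_antisymm (hte ▸ hall t htm) (h2 q' hq')
    · intro hqe t' ht'
      rw [hqe]; exact h2 t' ht'
end

section
/- Let F = (F^×, N_F) be a tract, Γ a linearly ordered abelian group, E a finite linearly ordered set, and 1 ≤ r ≤ |E|. Let P be a function from the r-subsets of E to F[Γ] that is not identically ∞. If P is a strong F[Γ]-Plücker vector (i.e. satisfies the Plücker relation 𝒫_{I;J} over F[Γ] for all (r−1)-subsets I and (r+1)-subsets J), then for every u ∈ Γ^E the initial function P^u is a strong F-Plücker vector; likewise, if P is a weak F[Γ]-Plücker vector (satisfies 𝒫_{I;J} whenever |J∖I| = 3), then every P^u is a weak F-Plücker vector. -/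
open scoped Classical

section Helpers

variable {α : Type*} [CommGroup α] {Γ : Type*} [AddCommGroup Γ] [LinearOrder Γ] [IsOrderedAddMonoid Γ]
  {E : Type*} [Fintype E] [LinearOrder E]

theorem aux_null (T : Tract α) (t : Multiset (α × Γ)) (c : Γ) (hc : ∀ p ∈ t, c ≤ p.2)
    (h : extNullMem T t) : Multiset.map Prod.fst (t.filter fun p => p.2 = c) ∈ T.null := by
  by_cases hex : ∃ p ∈ t, p.2 = c
  · obtain ⟨p0, hp0, hp0c⟩ := hex
    have : (t.filter fun p => p.2 = c) = t.filter fun p => ∀ q ∈ t, p.2 ≤ q.2 := by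
      apply Multiset.filter_congr
      intro p hp
      constructor
      · intro hpc q hq
        rw [hpc]; exact hc q hq
      · intro hq
        exact le_antisymm (hp0c ▸ hq p0 hp0) (hc p hp)
    rw [this]
    exact h
  · have : (t.filter fun p => p.2 = c) = 0 := by
      rw [Multiset.filter_eq_nil]
      intro p hp hpc
      exact hex ⟨p, hp, hpc⟩
    rw [this]
    simpa using T.zero_mem

theorem aux_filterMap (s : Multiset E) (f : E → Option (α × Γ)) (g : E → Option α) (c : Γ)
    (hg : ∀ j ∈ s, g j = (f j).bind fun p => if p.2 = c then some p.1 else none) :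
    (s.map g).filterMap id =
      Multiset.map Prod.fst (((s.map f).filterMap id).filter fun p => p.2 = c) := by
  induction s using Multiset.induction_on with
  | empty => simp
  | cons a s ih =>
    have ih' := ih (fun j hj => hg j (Multiset.mem_cons_of_mem hj))
    have ha := hg a (Multiset.mem_cons_self a s)
    rw [Multiset.map_cons, Multiset.map_cons]
    cases hfa : f a with
    | none =>
      rw [hfa] at ha
      have ha' : g a = none := by simpa using ha
      rw [ha', Multiset.filterMap_cons_none _ _ rfl, Multiset.filterMap_cons_none _ _ rfl]
      exact ih'
    | some p =>
      rw [hfa] at ha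
      rw [Multiset.filterMap_cons_some (id : Option (α × Γ) → Option (α × Γ)) (some p) _ rfl]
      by_cases hp : p.2 = c
      · have ha' : g a = some p.1 := by simpa [hp] using ha
        rw [ha', Multiset.filterMap_cons_some (id : Option α → Option α) (some p.1) _ rfl,
          Multiset.filter_cons_of_pos (p := fun p : α × Γ => p.2 = c) _ hp, Multiset.map_cons, ih']
      · have ha' : g a = none := by simpa [hp] using ha
        rw [ha', Multiset.filterMap_cons_none _ _ rfl, Multiset.filter_cons_of_neg (p := fun p : α × Γ => p.2 = c) _ hp, ih']

theorem aux_min (P : Finset E → Option (α × Γ)) (r : ℕ) (u : E → Γ)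
    (hP : ∃ B : Finset E, B.card = r ∧ P B ≠ none) :
    ∃ m : Γ, ∃ B0 : Finset E, B0.card = r ∧ (∃ p, P B0 = some p ∧ p.2 - ∑ i ∈ B0, u i = m) ∧
      ∀ B : Finset E, B.card = r → ∀ p, P B = some p → m ≤ p.2 - ∑ i ∈ B, u i := by
  obtain ⟨B1, hB1, hB1n⟩ := hP
  obtain ⟨B0, hB0, hmin⟩ := Finset.exists_min_image
    ((Finset.univ : Finset (Finset E)).filter fun B => B.card = r)
    (fun B => wsub (modu (P B)) (∑ i ∈ B, u i)) ⟨B1, by simp [hB1]⟩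
  have hB0' : B0.card = r := by simpa using hB0
  obtain ⟨p1, hp1⟩ := Option.ne_none_iff_exists'.1 hB1n
  cases h0 : P B0 with
  | none =>
    exfalso
    have := hmin B1 (by simp [hB1])
    rw [h0, hp1] at this
    exact absurd (top_le_iff.1 this) (WithTop.coe_ne_top (a := p1.2 - ∑ i ∈ B1, u i))
  | some p =>
    refine ⟨_, B0, hB0', ⟨p, h0, rfl⟩, ?_⟩
    intro B hB q hq
    have := hmin B (by simp [hB])
    rw [h0, hq] at this
    exact WithTop.coe_le_coe.1 this

theorem aux_initial (P : Finset E → Option (α × Γ)) (r : ℕ) (u : E → Γ) (m : Γ) (B0 : Finset E)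
    (hB0 : B0.card = r) (h0 : ∃ p, P B0 = some p ∧ p.2 - ∑ i ∈ B0, u i = m)
    (hm : ∀ B : Finset E, B.card = r → ∀ p, P B = some p → m ≤ p.2 - ∑ i ∈ B, u i)
    (B : Finset E) (hB : B.card = r) :
    initialFn P r u B = (P B).bind fun p => if p.2 - ∑ i ∈ B, u i = m then some p.1 else none := by
  obtain ⟨p0, hp0, hp0m⟩ := h0
  unfold initialFn
  cases hPB : P B with
  | none => simp
  | some p =>
    simp only [Option.map_some, Option.bind_some]
    by_cases h : p.2 - ∑ i ∈ B, u i = m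
    · rw [if_pos h, if_pos]
      intro B' hB'
      cases hq : P B' with
      | none => exact le_top
      | some q =>
        refine WithTop.coe_le_coe.2 ?_
        change p.2 - ∑ i ∈ B, u i ≤ q.2 - ∑ i ∈ B', u i
        rw [h]; exact hm B' hB' q hq
    · rw [if_neg h, if_neg]
      intro hall
      have := hall B0 hB0
      rw [hp0] at this
      have := WithTop.coe_le_coe.1 this
      exact h (le_antisymm (hp0m ▸ this) (hm B hB p hPB))

theorem aux_rel (T : Tract α) (P : Finset E → Option (α × Γ)) (r : ℕ) (u : E → Γ)
    (hP : ∃ B : Finset E, B.card = r ∧ P B ≠ none) (I J : Finset E) (hI : I.card + 1 = r)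
    (hJ : J.card = r + 1) (h : PluckerRelExt T P P I J) :
    PluckerRelF T (initialFn P r u) (initialFn P r u) I J := by
  obtain ⟨m, B0, hB0, h0, hm⟩ := aux_min P r u hP
  have hin := aux_initial P r u m B0 hB0 h0 hm
  have key : ∀ j ∈ J \ I, (insert j I).card = r ∧ (J.erase j).card = r ∧
      ∑ i ∈ insert j I, u i = u j + ∑ i ∈ I, u i ∧
      ∑ i ∈ J.erase j, u i = ∑ i ∈ J, u i - u j := by
    intro j hj
    rw [Finset.mem_sdiff] at hj
    refine ⟨by rw [Finset.card_insert_of_notMem hj.2, hI],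
      by rw [Finset.card_erase_of_mem hj.1, hJ]; rfl, Finset.sum_insert hj.2, ?_⟩
    rw [← Finset.add_sum_erase J u hj.1]; abel
  unfold PluckerRelF
  rw [aux_filterMap _ (fun j => oMul extMul (some (plSign T j I J, (0 : Γ)))
      (oMul extMul (P (insert j I)) (P (J.erase j)))) _ (m + m + (∑ i ∈ I, u i + ∑ i ∈ J, u i))]
  · refine aux_null T _ _ ?_ h
    intro p hp
    rw [Multiset.mem_filterMap] at hp
    obtain ⟨o, ho, rfl' : o = some p⟩ := hp
    subst rfl'
    obtain ⟨j, hj, hjp⟩ := Multiset.mem_map.1 ho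
    obtain ⟨k1, k2, k3, k4⟩ := key j hj
    cases h1 : P (insert j I) with
    | none => rw [h1] at hjp; cases hjp
    | some a =>
      cases h2 : P (J.erase j) with
      | none => rw [h1, h2] at hjp; cases hjp
      | some b =>
        rw [h1, h2] at hjp
        have hh := Option.some.inj hjp
        have m1 := hm _ k1 a h1
        have m2 := hm _ k2 b h2
        rw [k3] at m1
        rw [k4] at m2
        have := add_le_add m1 m2
        rw [← hh]
        change _ ≤ 0 + (a.2 + b.2)
        have e : a.2 - (u j + ∑ i ∈ I, u i) + (b.2 - (∑ i ∈ J, u i - u j)) =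
          0 + (a.2 + b.2) - (∑ i ∈ I, u i + ∑ i ∈ J, u i) := by abel
        rw [e] at this
        exact le_sub_iff_add_le.1 this
  · intro j hj
    obtain ⟨k1, k2, k3, k4⟩ := key j hj
    rw [hin _ k1, hin _ k2]
    cases h1 : P (insert j I) with
    | none => rfl
    | some a =>
      cases h2 : P (J.erase j) with
      | none =>
        simp only [Option.bind_some, Option.bind_none]
        split_ifs <;> rfl
      | some b =>
        have m1 := hm _ k1 a h1
        have m2 := hm _ k2 b h2
        rw [k3] at m1 ⊢
        rw [k4] at m2 ⊢
        have e : a.2 - (u j + ∑ i ∈ I, u i) + (b.2 - (∑ i ∈ J, u i - u j)) =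
          0 + (a.2 + b.2) - (∑ i ∈ I, u i + ∑ i ∈ J, u i) := by abel
        simp only [Option.bind_some, oMul, extMul]
        by_cases ha : a.2 - (u j + ∑ i ∈ I, u i) = m
        · by_cases hb : b.2 - (∑ i ∈ J, u i - u j) = m
          · rw [if_pos ha, if_pos hb, if_pos]
            rw [ha, hb] at e
            rw [e]; abel
          · rw [if_pos ha, if_neg hb, if_neg]
            intro hc
            rw [hc, ha, add_sub_cancel_right] at e
            exact hb (add_left_cancel e)
        · have hne : ¬ (0 + (a.2 + b.2) = m + m + (∑ i ∈ I, u i + ∑ i ∈ J, u i)) := by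
            intro hc
            have l1 := lt_of_le_of_ne m1 (Ne.symm ha)
            have := add_lt_add_of_lt_of_le l1 m2
            rw [e, hc, add_sub_cancel_right] at this
            exact lt_irrefl _ this
          rw [if_neg ha, if_neg hne]

theorem aux_nonzero (P : Finset E → Option (α × Γ)) (r : ℕ) (u : E → Γ)
    (hP : ∃ B : Finset E, B.card = r ∧ P B ≠ none) :
    ∃ B : Finset E, B.card = r ∧ initialFn P r u B ≠ none := by
  obtain ⟨m, B0, hB0, h0, hm⟩ := aux_min P r u hP
  refine ⟨B0, hB0, ?_⟩
  rw [aux_initial P r u m B0 hB0 h0 hm B0 hB0]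
  obtain ⟨p, hp, hpm⟩ := h0
  simp [hp, hpm]

end Helpers

/-- If `P`, a function on the `r`-subsets of `E` with values in `F[Γ]` that is
not identically `∞`, is a strong `F[Γ]`-Plücker vector then every initial function `P^u` is a
strong `F`-Plücker vector; likewise, if `P` is a weak `F[Γ]`-Plücker vector then every `P^u`
is a weak `F`-Plücker vector. -/
theorem initial_of_strong_and_weak_pluckerVector
    {α : Type*} [CommGroup α] {Γ : Type*} [AddCommGroup Γ] [LinearOrder Γ] [IsOrderedAddMonoid Γ]
    {E : Type*} [Fintype E] [LinearOrder E]
    (T : Tract α) (r : ℕ) (hr1 : 1 ≤ r) (hr2 : r ≤ Fintype.card E)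
    (P : Finset E → Option (α × Γ))
    (hP : ∃ B : Finset E, B.card = r ∧ P B ≠ none) :
    ((∀ I J : Finset E, I.card + 1 = r → J.card = r + 1 → PluckerRelExt T P P I J) →
      ∀ u : E → Γ,
        (∃ B : Finset E, B.card = r ∧ initialFn P r u B ≠ none) ∧
        ∀ I J : Finset E, I.card + 1 = r → J.card = r + 1 →
          PluckerRelF T (initialFn P r u) (initialFn P r u) I J) ∧
    ((∀ I J : Finset E, I.card + 1 = r → J.card = r + 1 → (J \ I).card = 3 →
        PluckerRelExt T P P I J) →
      ∀ u : E → Γ,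
        (∃ B : Finset E, B.card = r ∧ initialFn P r u B ≠ none) ∧
        ∀ I J : Finset E, I.card + 1 = r → J.card = r + 1 → (J \ I).card = 3 →
          PluckerRelF T (initialFn P r u) (initialFn P r u) I J) := by
  exact ⟨fun h u => ⟨aux_nonzero P r u hP, fun I J hI hJ => aux_rel T P r u hP I J hI hJ (h I J hI hJ)⟩,
    fun h u => ⟨aux_nonzero P r u hP,
      fun I J hI hJ h3 => aux_rel T P r u hP I J hI hJ (h I J hI hJ h3)⟩⟩
end

section
/- Let F = (F^×, N_F) be a tract, Γ a linearly ordered abelian group, E a finite linearly ordered set, and r ≤ s positive integers. Let P be an arbitrary function from the r-subsets of E to F[Γ] and Q an arbitrary function from the s-subsets of E to F[Γ]. Fix an (r−1)-subset I and an (s+1)-subset J of E. If P and Q satisfy the Plücker incidence relation 𝒫^{r,s}_{I;J} over F[Γ], then for every u ∈ Γ^E the initial functions P^u and Q^u satisfy the Plücker incidence relation 𝒫^{r,s}_{I;J} over F. -/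
open scoped Classical

theorem ms_filterMap_congr {β γ : Type*} {f g : β → Option γ} {S : Multiset β}
    (h : ∀ x ∈ S, f x = g x) : S.filterMap f = S.filterMap g := by
  induction S using Quotient.inductionOn with
  | _ l => exact congrArg _ (List.filterMap_congr h)

theorem initialFn_min
    {α : Type*} [CommGroup α] {Γ : Type*} [AddCommGroup Γ] [LinearOrder Γ] [IsOrderedAddMonoid Γ]
    {E : Type*} [Fintype E] [LinearOrder E]
    (P : Finset E → Option (α × Γ)) (r : ℕ) (u : E → Γ) (B₀ : Finset E)
    (hB : B₀.card = r) (h : initialFn P r u B₀ ≠ none) :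
    ∃ m : Γ, (∃ p, P B₀ = some p ∧ p.2 - ∑ i ∈ B₀, u i = m) ∧
      ∀ B : Finset E, B.card = r → (P B = none ∧ initialFn P r u B = none) ∨
        ∃ p, P B = some p ∧ m ≤ p.2 - ∑ i ∈ B, u i ∧
          initialFn P r u B = if p.2 - ∑ i ∈ B, u i ≤ m then some p.1 else none := by
  unfold initialFn at h
  split_ifs at h with hmin
  · cases hp : P B₀ with
    | none => simp [hp] at h
    | some p₀ =>
      have hm : ∀ B' : Finset E, B'.card = r → ∀ p, P B' = some p →
          p₀.2 - ∑ i ∈ B₀, u i ≤ p.2 - ∑ i ∈ B', u i := by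
        intro B' hB' p hp'
        have := hmin B' hB'
        rw [hp, hp'] at this
        exact WithTop.coe_le_coe.1 this
      refine ⟨_, ⟨p₀, rfl, rfl⟩, fun B hBc => ?_⟩
      cases hpB : P B with
      | none => left; simp [initialFn, hpB]
      | some p =>
        right
        refine ⟨p, rfl, hm B hBc p hpB, ?_⟩
        unfold initialFn
        rw [hpB]
        refine if_congr ⟨fun H => ?_, fun H B' hB' => ?_⟩ rfl rfl
        · have := H B₀ hB
          rw [hp] at this
          exact WithTop.coe_le_coe.1 this
        · cases hp' : P B' with
          | none => exact le_top
          | some p' => exact WithTop.coe_le_coe.2 (H.trans (hm B' hB' p' hp'))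
  · exact absurd rfl h

/-- If arbitrary functions `P` (on `r`-subsets) and `Q` (on `s`-subsets) with
values in `F[Γ]` satisfy the Plücker incidence relation `𝒫^{r,s}_{I;J}` over `F[Γ]` for a fixed
`(r-1)`-subset `I` and `(s+1)`-subset `J`, then for every `u ∈ Γ^E` the initial functions
`P^u` and `Q^u` satisfy `𝒫^{r,s}_{I;J}` over `F`. -/
theorem initial_of_pluckerIncidenceRelation
    {α : Type*} [CommGroup α] {Γ : Type*} [AddCommGroup Γ] [LinearOrder Γ] [IsOrderedAddMonoid Γ]
    {E : Type*} [Fintype E] [LinearOrder E]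
    (T : Tract α) (r s : ℕ) (hr : 0 < r) (hrs : r ≤ s)
    (P Q : Finset E → Option (α × Γ)) (I J : Finset E)
    (hI : I.card + 1 = r) (hJ : J.card = s + 1)
    (h : PluckerRelExt T P Q I J) :
    ∀ u : E → Γ, PluckerRelF T (initialFn P r u) (initialFn Q s u) I J := by
  intro u
  have hcI : ∀ j ∈ J \ I, (insert j I).card = r := fun j hj => by
    rw [Finset.card_insert_of_notMem (Finset.mem_sdiff.1 hj).2, hI]
  have hcJ : ∀ j ∈ J \ I, (J.erase j).card = s := fun j hj => by
    rw [Finset.card_erase_of_mem (Finset.mem_sdiff.1 hj).1, hJ]; rfl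
  have hsum : ∀ j ∈ J \ I, ∑ i ∈ insert j I, u i + ∑ i ∈ J.erase j, u i
      = ∑ i ∈ I, u i + ∑ i ∈ J, u i := fun j hj => by
    rw [Finset.sum_insert (Finset.mem_sdiff.1 hj).2,
      ← Finset.add_sum_erase J u (Finset.mem_sdiff.1 hj).1]
    abel
  unfold PluckerRelExt extNullMem at h
  unfold PluckerRelF
  rw [Multiset.filterMap_map] at h ⊢
  by_cases hex : ∃ j ∈ J \ I, initialFn P r u (insert j I) ≠ none ∧
      initialFn Q s u (J.erase j) ≠ none
  · obtain ⟨j₀, hj₀, hP, hQ⟩ := hex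
    obtain ⟨m, ⟨p₀, hp₀, hpm⟩, hPm⟩ := initialFn_min P r u _ (hcI j₀ hj₀) hP
    obtain ⟨n, ⟨q₀, hq₀, hqn⟩, hQn⟩ := initialFn_min Q s u _ (hcJ j₀ hj₀) hQ
    set C := ∑ i ∈ I, u i + ∑ i ∈ J, u i with hC
    generalize hM : Multiset.filterMap _ (J \ I).val = M at h
    have hmem : (plSign T j₀ I J * (p₀.1 * q₀.1), m + n + C) ∈ M := by
      rw [← hM, Multiset.mem_filterMap]
      refine ⟨j₀, hj₀, ?_⟩
      simp only [Function.comp, hp₀, hq₀, oMul, extMul, id]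
      rw [← hsum j₀ hj₀, ← hpm, ← hqn]
      congr 2
      abel
    have hge : ∀ x ∈ M, m + n + C ≤ x.2 := by
      intro x hx
      rw [← hM, Multiset.mem_filterMap] at hx
      obtain ⟨j, hj, hx⟩ := hx
      have hj : j ∈ J \ I := hj
      rcases hPm _ (hcI j hj) with ⟨h1, -⟩ | ⟨p, hp, h1, -⟩
      · simp [h1, oMul] at hx
      rcases hQn _ (hcJ j hj) with ⟨h2, -⟩ | ⟨q, hq, h2, -⟩
      · simp [h2, hp, oMul] at hx
      simp only [Function.comp, hp, hq, oMul, extMul, id, Option.some.injEq] at hx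
      rw [← hx, ← hsum j hj]
      calc _ ≤ _ := add_le_add_left (add_le_add h1 h2) _
        _ = _ := by simp only; abel
    have hfil : M.filter (fun p => ∀ q ∈ M, p.2 ≤ q.2) = M.filter (fun p => p.2 ≤ m + n + C) :=
      Multiset.filter_congr fun x hx =>
        ⟨fun H => H _ hmem, fun H y hy => H.trans (hge y hy)⟩
    rw [hfil, ← hM, Multiset.filter_filterMap, Multiset.map_filterMap] at h
    convert h using 1
    refine ms_filterMap_congr fun j hj => ?_
    have hj : j ∈ J \ I := hj
    rcases hPm _ (hcI j hj) with ⟨h1, h1'⟩ | ⟨p, hp, h1, h1'⟩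
    · simp [h1, h1', oMul]
    rcases hQn _ (hcJ j hj) with ⟨h2, h2'⟩ | ⟨q, hq, h2, h2'⟩
    · simp [h2, h2', hp, oMul]
    have key : p.2 + q.2 ≤ m + n + C ↔
        p.2 - ∑ i ∈ insert j I, u i ≤ m ∧ q.2 - ∑ i ∈ J.erase j, u i ≤ n := by
      have e : p.2 + q.2 = (p.2 - ∑ i ∈ insert j I, u i) + (q.2 - ∑ i ∈ J.erase j, u i) + C := by
        rw [← hsum j hj]; abel
      rw [e, add_le_add_iff_right]
      refine ⟨fun H => ⟨?_, ?_⟩, fun H => add_le_add H.1 H.2⟩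
      · by_contra hc
        exact absurd H (not_le.2 (add_lt_add_of_lt_of_le (not_le.1 hc) h2))
      · by_contra hc
        exact absurd H (not_le.2 (add_lt_add_of_le_of_lt h1 (not_le.1 hc)))
    rw [Function.comp, h1', h2']
    simp only [Function.comp, hp, hq, oMul, extMul, id, zero_add, Option.bind_some, key]
    by_cases c1 : p.2 - ∑ i ∈ insert j I, u i ≤ m <;>
    by_cases c2 : q.2 - ∑ i ∈ J.erase j, u i ≤ n <;>
    simp [c1, c2, key, oMul] <;>
    exact not_le.1 fun H => by
      first
        | exact c1 (key.1 H).1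
        | exact c2 (key.1 H).2
  · push Not at hex
    convert T.zero_mem
    rw [Multiset.eq_zero_iff_forall_notMem]
    intro a ha
    rw [Multiset.mem_filterMap] at ha
    obtain ⟨j, hj, ha⟩ := ha
    have hj : j ∈ J \ I := hj
    have := hex j hj
    simp only [Function.comp, id] at ha
    cases h1 : initialFn P r u (insert j I) with
    | none => simp [h1, oMul] at ha
    | some x =>
      rw [h1] at this
      simp [h1, this (by simp), oMul] at ha
end

section
/- Let F = (F^×, N_F) be a tract, E and A disjoint finite sets with a linear order on E⊔A extending a linear order on each, and r ≤ s positive integers. Let P be a function from the r-subsets of E to F and Q a function from the s-subsets of E to F, and suppose P and Q satisfy the Plücker incidence relation 𝒫^{r,s}_{I;J} over F for every (r−1)-subset I and (s+1)-subset J of E. (a) Define the loop extensions P̃ on r-subsets of E⊔A by P̃(I) = P(I) if I∩A = ∅ and P̃(I) = 0 otherwise, and Q̃ analogously on s-subsets; then P̃ and Q̃ satisfy 𝒫^{r,s}_{I;J} for every (r−1)-subset I and (s+1)-subset J of E⊔A. (b) Define the coloop extensions P̂ on (r+|A|)-subsets of E⊔A by P̂(I) = P(I∖A) if A ⊆ I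 and P̂(I) = 0 otherwise, and Q̂ analogously on (s+|A|)-subsets; then P̂ and Q̂ satisfy 𝒫^{r+|A|, s+|A|}_{I;J} for every (r+|A|−1)-subset I and (s+|A|+1)-subset J of E⊔A. -/
open scoped Classical

theorem minusOne_mul_self' {α : Type*} [CommGroup α] (T : Tract α) :
    T.minusOne * T.minusOne = 1 := by
  have h1 : ({1, T.minusOne} : Multiset α) ∈ T.null := T.existsUnique_minusOne.choose_spec.1
  have h2 := T.scale_mem T.minusOne⁻¹ _ h1
  have h3 : ({1, T.minusOne⁻¹} : Multiset α) ∈ T.null := by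
    rw [Multiset.pair_comm]
    simpa using h2
  have h4 : T.minusOne⁻¹ = T.minusOne := T.existsUnique_minusOne.choose_spec.2 _ h3
  calc T.minusOne * T.minusOne = T.minusOne⁻¹ * T.minusOne := by rw [h4]
    _ = 1 := inv_mul_cancel _

theorem oMul_none_right' {β : Type*} (m : β → β → β) (a : Option β) : oMul m a none = none := by
  cases a <;> rfl

theorem oMul_none_left' {β : Type*} (m : β → β → β) (a : Option β) : oMul m none a = none := by
  cases a <;> rfl

theorem pluckerRelF_of_none {α : Type*} [CommGroup α] {X : Type*} [Fintype X] [LinearOrder X]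
    (T : Tract α) (P Q : Finset X → Option α) (I J : Finset X)
    (h : ∀ j ∈ J, j ∉ I → P (insert j I) = none ∨ Q (J.erase j) = none) :
    PluckerRelF T P Q I J := by
  unfold PluckerRelF
  have : Multiset.map (fun j => oMul (· * ·) (some (plSign T j I J))
      (oMul (· * ·) (P (insert j I)) (Q (J.erase j)))) (J \ I).val
      = Multiset.map (fun _ => (none : Option α)) (J \ I).val := by
    apply Multiset.map_congr rfl
    intro j hj
    have hj' : j ∈ J ∧ j ∉ I := Finset.mem_sdiff.1 hj
    rcases h j hj'.1 hj'.2 with h | h <;> simp [h, oMul_none_right', oMul_none_left']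
  rw [this, Multiset.filterMap_map]
  have h0 : Multiset.filterMap (id ∘ fun _ : X => (none : Option α)) (J \ I).val = 0 := by
    rw [Multiset.eq_zero_iff_forall_notMem]
    intro a ha
    simp at ha
  rw [h0]
  exact T.zero_mem

theorem plSign_sdiff {α : Type*} [CommGroup α] {X : Type*} [Fintype X] [LinearOrder X]
    (T : Tract α) (j : X) (I J A : Finset X) (hI : A ⊆ I) (hJ : A ⊆ J) :
    plSign T j I J = plSign T j (I \ A) (J \ A) := by
  have key : ∀ K : Finset X, A ⊆ K → (K.filter fun x => j < x).card
      = ((K \ A).filter fun x => j < x).card + (A.filter fun x => j < x).card := by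
    intro K hK
    rw [← Finset.card_union_of_disjoint, ← Finset.filter_union, Finset.sdiff_union_of_subset hK]
    exact Finset.disjoint_filter_filter Finset.sdiff_disjoint
  unfold plSign
  rw [key I hI, key J hJ, add_add_add_comm, pow_add _ _ (_ + _), pow_add _ (Finset.card (A.filter _)),
    ← mul_pow, minusOne_mul_self', one_pow, mul_one]

/-- Extending a pair of functions satisfying all Plücker incidence relations on
subsets of `E` by loops (part (a)) or by coloops (part (b)) on a set `A` disjoint from `E`
again yields functions satisfying all Plücker incidence relations on subsets of `E ⊔ A`. -/
theorem pluckerIncidence_loop_and_coloop_extension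
    {α : Type*} [CommGroup α] {X : Type*} [Fintype X] [LinearOrder X]
    (T : Tract α) (E A : Finset X) (hEA : Disjoint E A)
    (r s : ℕ) (hr : 0 < r) (hrs : r ≤ s)
    (P Q : Finset X → Option α)
    (h : ∀ I J : Finset X, I ⊆ E → J ⊆ E → I.card + 1 = r → J.card = s + 1 →
      PluckerRelF T P Q I J) :
    (∀ I J : Finset X, I ⊆ E ∪ A → J ⊆ E ∪ A → I.card + 1 = r → J.card = s + 1 →
      PluckerRelF T (fun B => if Disjoint B A then P B else none)
        (fun B => if Disjoint B A then Q B else none) I J) ∧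
    (∀ I J : Finset X, I ⊆ E ∪ A → J ⊆ E ∪ A →
        I.card + 1 = r + A.card → J.card = s + A.card + 1 →
      PluckerRelF T (fun B => if A ⊆ B then P (B \ A) else none)
        (fun B => if A ⊆ B then Q (B \ A) else none) I J) := by
  constructor
  · intro I J hI hJ hIc hJc
    by_cases hIA : Disjoint I A
    · by_cases hJA : Disjoint J A
      · have hIE : I ⊆ E := Disjoint.left_le_of_le_sup_right hI hIA
        have hJE : J ⊆ E := Disjoint.left_le_of_le_sup_right hJ hJA
        have := h I J hIE hJE hIc hJc
        unfold PluckerRelF at this ⊢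
        convert this using 2
        apply Multiset.map_congr rfl
        intro j hj
        have hj' : j ∈ J ∧ j ∉ I := Finset.mem_sdiff.1 hj
        have h1 : Disjoint (insert j I) A :=
          Finset.disjoint_insert_left.2 ⟨Finset.disjoint_left.1 hJA hj'.1, hIA⟩
        have h2 : Disjoint (J.erase j) A := hJA.mono_left (Finset.erase_subset _ _)
        simp only [h1, h2, if_true]
      · apply pluckerRelF_of_none
        intro j hj hjI
        by_cases hjA : j ∈ A
        · left
          exact if_neg fun hd => (Finset.disjoint_insert_left.1 hd).1 hjA
        · right
          refine if_neg fun hd => hJA ?_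
          rw [← Finset.insert_erase hj]
          exact Finset.disjoint_insert_left.2 ⟨hjA, hd⟩
    · apply pluckerRelF_of_none
      intro j hj hjI
      left
      exact if_neg fun hd => hIA (Finset.disjoint_insert_left.1 hd).2
  · intro I J hI hJ hIc hJc
    by_cases hJA : A ⊆ J
    · by_cases hIA : A ⊆ I
      · have hsub : ∀ K : Finset X, K ⊆ E ∪ A → K \ A ⊆ E := by
          intro K hK x hx
          have hx' := Finset.mem_sdiff.1 hx
          exact (Finset.mem_union.1 (hK hx'.1)).resolve_right hx'.2
        have c1 := Finset.card_sdiff_add_card_eq_card hIA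
        have c2 := Finset.card_sdiff_add_card_eq_card hJA
        have := h (I \ A) (J \ A) (hsub I hI) (hsub J hJ) (by omega) (by omega)
        unfold PluckerRelF at this ⊢
        have hs : (J \ A) \ (I \ A) = J \ I := by
          ext x
          have := @hIA x
          simp only [Finset.mem_sdiff]
          tauto
        rw [hs] at this
        convert this using 2
        apply Multiset.map_congr rfl
        intro j hj
        have hj' : j ∈ J ∧ j ∉ I := Finset.mem_sdiff.1 hj
        have hjA : j ∉ A := fun hh => hj'.2 (hIA hh)
        have h1 : A ⊆ insert j I := hIA.trans (Finset.subset_insert _ _)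
        have h2 : A ⊆ J.erase j := Finset.subset_erase.2 ⟨hJA, hjA⟩
        simp only [h1, h2, if_true]
        rw [plSign_sdiff T j I J A hIA hJA, Finset.insert_sdiff_of_notMem _ hjA,
          Finset.erase_sdiff_comm]
      · apply pluckerRelF_of_none
        intro j hj hjI
        by_cases hjA : j ∈ A
        · right
          exact if_neg fun hd => Finset.notMem_erase j J (hd hjA)
        · left
          exact if_neg fun hd => hIA ((Finset.subset_insert_iff_of_notMem hjA).1 hd)
    · apply pluckerRelF_of_none
      intro j hj hjI
      right
      exact if_neg fun hd => hJA (hd.trans (Finset.erase_subset _ _))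
end

section
/- Let K be an infinite field, Γ a linearly ordered abelian group, E a finite set, and L ⊆ K((Γ))^E a K((Γ))-linear subspace of the space of E-tuples of Hahn series. Then a tuple X ∈ (Γ∪{∞})^E lies in the coordinatewise valuation image {(val(x_i))_{i∈E} : x ∈ L} if and only if, for every circuit c of L^⊥, the minimum over i ∈ E of X_i + val(c_i) (computed in Γ∪{∞}) is either ∞ or attained at at least two distinct indices i. (This is the case ν = val of the Proposition on tropicalisation: ν(𝒱*(N)) = 𝒱*(ν_*(N)) for every K((Γ))-matroid N.) -/
open scoped Classical

/-- `c` is a circuit of the set `S` of tuples: a nonzero element of `S` whose support is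
inclusion-minimal among the supports of nonzero elements of `S`. -/
def IsCircuitOf {E β : Type*} [Zero β] (S : Set (E → β)) (c : E → β) : Prop :=
  c ∈ S ∧ c ≠ 0 ∧ ∀ y ∈ S, y ≠ 0 →
    {i | y i ≠ 0} ⊆ {i | c i ≠ 0} → {i | y i ≠ 0} = {i | c i ≠ 0}

/-- The orthogonal complement `L^⊥` of a set of tuples of Hahn series. -/
def perpSet {K : Type*} [Field K] {Γ : Type*} [AddCommGroup Γ] [LinearOrder Γ] [IsOrderedAddMonoid Γ]
    {E : Type*} [Fintype E] (L : Set (E → HahnSeries Γ K)) : Set (E → HahnSeries Γ K) :=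
  {y | ∀ x ∈ L, ∑ i, x i * y i = 0}

section aux
variable {K : Type*} [Field K] {Γ : Type*} [AddCommGroup Γ] [LinearOrder Γ] [IsOrderedAddMonoid Γ]
  {E : Type*} [Fintype E]

theorem aux_lt_sum {ι : Type*} (s : Finset ι) (f : ι → HahnSeries Γ K) (a : WithTop Γ) (ha : a < ⊤)
    (h : ∀ j ∈ s, a < (f j).orderTop) : a < (∑ j ∈ s, f j).orderTop := by
  induction s using Finset.induction_on with
  | empty => simpa using ha
  | insert b s hb ih =>
    rw [Finset.sum_insert hb]
    refine lt_of_lt_of_le (lt_min (h b (Finset.mem_insert_self _ _))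
      (ih fun j hj => h j (Finset.mem_insert_of_mem hj))) HahnSeries.min_orderTop_le_orderTop_add

theorem aux_unique_min (f : E → HahnSeries Γ K) (i : E)
    (h : ∀ j, j ≠ i → (f i).orderTop < (f j).orderTop) (hi : (f i).orderTop < ⊤)
    (hs : ∑ j, f j = 0) : False := by
  have h1 := aux_lt_sum (Finset.univ.erase i) f _ hi (fun j hj => h j (Finset.ne_of_mem_erase hj))
  rw [← Finset.add_sum_erase _ _ (Finset.mem_univ i)] at hs
  have h2 := eq_neg_of_add_eq_zero_left hs
  have h3 : (f i).orderTop = (∑ j ∈ Finset.univ.erase i, f j).orderTop := by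
    rw [h2, HahnSeries.orderTop_neg]
  exact absurd h1 (by rw [h3]; exact lt_irrefl _)

/-- the adjusted tuple -/
theorem aux_adjust (L : Submodule (HahnSeries Γ K) (E → HahnSeries Γ K)) (x : E → HahnSeries Γ K)
    (hx : x ∈ L) (k : E) (hk : x k ≠ 0) (y : E → HahnSeries Γ K)
    (hy : y ∈ perpSet ((L ⊓ LinearMap.ker (LinearMap.proj (R := HahnSeries Γ K)
      (φ := fun _ : E => HahnSeries Γ K) k) : Submodule _ _) : Set (E → HahnSeries Γ K))) :
    ∃ y' ∈ perpSet (L : Set (E → HahnSeries Γ K)), (∀ j, j ≠ k → y' j = y j) ∧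
      x k * y' k = - ∑ j ∈ Finset.univ.erase k, x j * y j := by
  refine ⟨Function.update y k (-(∑ j ∈ Finset.univ.erase k, x j * y j) / x k), ?_, ?_, ?_⟩
  · have key : ∀ z : E → HahnSeries Γ K, ∑ j, z j * Function.update y k (-(∑ j ∈ Finset.univ.erase k, x j * y j) / x k) j
        = z k * (-(∑ j ∈ Finset.univ.erase k, x j * y j) / x k) + ∑ j ∈ Finset.univ.erase k, z j * y j := by
      intro z
      rw [← Finset.add_sum_erase _ _ (Finset.mem_univ k)]
      congr 1
      · simp
      · refine Finset.sum_congr rfl fun j hj => ?_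
        rw [Function.update_of_ne (Finset.ne_of_mem_erase hj)]
    intro z hz
    have hw := hy (z - (z k / x k) • x) (by
      refine ⟨L.sub_mem hz (L.smul_mem _ hx), ?_⟩
      simp [hk])
    rw [key z]
    rw [← Finset.add_sum_erase _ _ (Finset.mem_univ k)] at hw
    simp only [Pi.sub_apply, Pi.smul_apply, smul_eq_mul, sub_mul, Finset.sum_sub_distrib] at hw
    have e : ∑ j ∈ Finset.univ.erase k, z k / x k * x j * y j
        = z k / x k * ∑ j ∈ Finset.univ.erase k, x j * y j := by
      rw [Finset.mul_sum]; exact Finset.sum_congr rfl fun j _ => by ring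
    rw [e] at hw
    have e2 : z k / x k * x k = z k := div_mul_cancel₀ _ hk
    rw [e2] at hw
    rw [← hw]; ring
  · intro j hj
    rw [Function.update_of_ne hj]
  · simp only [Function.update_self]
    exact mul_div_cancel₀ _ hk

theorem aux_scale (X : E → WithTop Γ) (x : E → HahnSeries Γ K) (hx0 : x ≠ 0)
    (hx : ∀ j, X j = ⊤ → x j = 0) : ∃ (t : HahnSeries Γ K) (k : E), t * x k ≠ 0 ∧
      (t * x k).orderTop = X k ∧ ∀ j, X j ≤ (t * x j).orderTop := by
  obtain ⟨j0, hj0⟩ := Function.ne_iff.mp hx0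
  obtain ⟨k, hk, hmin⟩ := Finset.exists_min_image (Finset.univ.filter fun j => x j ≠ 0)
    (fun j => (x j).order - (X j).untopD 0) ⟨j0, by simpa using hj0⟩
  simp only [Finset.mem_filter, Finset.mem_univ, true_and] at hk hmin
  have hord : ∀ j, x j ≠ 0 → (HahnSeries.single ((X k).untopD 0 - (x k).order) (1 : K) * x j).orderTop
      = (((X k).untopD 0 - (x k).order + (x j).order : Γ) : WithTop Γ) := by
    intro j hj
    rw [HahnSeries.orderTop_mul, HahnSeries.orderTop_single one_ne_zero,
      ← HahnSeries.order_eq_orderTop_of_ne_zero hj]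
    rfl
  have hX : ∀ j, x j ≠ 0 → X j = (((X j).untopD 0 : Γ) : WithTop Γ) := by
    intro j hj
    have : X j ≠ ⊤ := fun h => hj (hx j h)
    lift X j to Γ using this with a
    rfl
  refine ⟨HahnSeries.single ((X k).untopD 0 - (x k).order) (1 : K), k, ?_, ?_, ?_⟩
  · exact mul_ne_zero (by simp) hk
  · rw [hord k hk, hX k hk]; simp
  · intro j
    by_cases hj : x j = 0
    · simp [hj]
    · rw [hord j hj, hX j hj, WithTop.coe_le_coe]
      have := hmin j hj
      rw [sub_le_sub_iff] at this
      rw [← sub_nonneg]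
      have h2 := sub_nonneg.mpr this
      convert h2 using 1
      abel

theorem aux_farkas (X : E → WithTop Γ) (i : E) (hi : X i ≠ ⊤)
    (L : Submodule (HahnSeries Γ K) (E → HahnSeries Γ K)) :
    (∃ x ∈ L, (x i).orderTop = X i ∧ ∀ j, X j ≤ (x j).orderTop) ∨
    ∃ y ∈ perpSet (L : Set (E → HahnSeries Γ K)), y i ≠ 0 ∧ ∀ j, j ≠ i →
      X i + (y i).orderTop < X j + (y j).orderTop := by
  induction L using WellFoundedLT.induction with
  | ind L ih =>
  have hlt : ∀ x ∈ L, ∀ k, x k ≠ 0 → (L ⊓ LinearMap.ker (LinearMap.proj (R := HahnSeries Γ K)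
      (φ := fun _ : E => HahnSeries Γ K) k) : Submodule _ _) < L := by
    intro x hx k hk
    refine lt_of_le_of_ne inf_le_left fun h => ?_
    rw [← h] at hx
    exact hk hx.2
  by_cases hc : ∃ x ∈ L, ∃ k, X k = ⊤ ∧ x k ≠ 0
  · obtain ⟨x, hx, k, hXk, hk⟩ := hc
    rcases ih _ (hlt x hx k hk) with ⟨z, hz, h⟩ | ⟨y, hy, hyi0, h⟩
    · exact Or.inl ⟨z, hz.1, h⟩
    · have hik : i ≠ k := by rintro rfl; exact hi hXk
      obtain ⟨y', hy', h1, -⟩ := aux_adjust L x hx k hk y hy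
      refine Or.inr ⟨y', hy', by rwa [h1 i hik], fun j hj => ?_⟩
      rw [h1 i hik]
      by_cases hjk : j = k
      · subst hjk
        have := h j hj
        rw [hXk, top_add] at this ⊢
        exact this
      · rw [h1 j hjk]; exact h j hj
  push Not at hc
  by_cases hL : ∃ x ∈ L, x ≠ 0
  · obtain ⟨x0, hx0, hne⟩ := hL
    obtain ⟨t, k, hk, hvk, hv⟩ := aux_scale X x0 hne (fun j hj => hc x0 hx0 j hj)
    have hx : t • x0 ∈ L := L.smul_mem t hx0
    by_cases hgood : (t * x0 i).orderTop = X i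
    · exact Or.inl ⟨t • x0, hx, hgood, hv⟩
    have hik : i ≠ k := by rintro rfl; exact hgood hvk
    have hgt : X i < (t * x0 i).orderTop := lt_of_le_of_ne (hv i) (Ne.symm hgood)
    rcases ih _ (hlt (t • x0) hx k hk) with ⟨z, hz, h⟩ | ⟨y, hy, hyi0, h⟩
    · exact Or.inl ⟨z, hz.1, h⟩
    · obtain ⟨y', hy', h1, h2⟩ := aux_adjust L (t • x0) hx k hk y hy
      refine Or.inr ⟨y', hy', by rwa [h1 i hik], fun j hj => ?_⟩
      rw [h1 i hik]
      by_cases hjk : j = k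
      · subst hjk
        have hfin : X i + (y i).orderTop < ⊤ := lt_of_lt_of_le (h j hj) le_top
        have hyi : (y i).orderTop ≠ ⊤ := by
          intro hh; rw [hh, add_top] at hfin; exact lt_irrefl _ hfin
        rw [← hvk, ← HahnSeries.orderTop_mul]
        change _ < ((t • x0) j * y' j).orderTop
        rw [h2, HahnSeries.orderTop_neg]
        refine aux_lt_sum _ _ _ hfin fun l hl => ?_
        rw [HahnSeries.orderTop_mul]
        by_cases hli : l = i
        · subst hli
          exact WithTop.add_lt_add_right hyi hgt
        · exact lt_of_lt_of_le (h l hli) (add_le_add_left (hv l) _)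
      · rw [h1 j hjk]; exact h j hj
  · push Not at hL
    refine Or.inr ⟨Pi.single i 1, fun z hz => by simp [hL z hz], by simp, fun j hj => ?_⟩
    rw [Pi.single_eq_same, Pi.single_eq_of_ne hj, HahnSeries.orderTop_one]
    simpa [lt_top_iff_ne_top] using hi

theorem aux_circuit (X : E → WithTop Γ) (i : E)
    (L : Submodule (HahnSeries Γ K) (E → HahnSeries Γ K)) (hi : X i ≠ ⊤)
    (n : ℕ) (y : E → HahnSeries Γ K) (hn : (Finset.univ.filter fun j => y j ≠ 0).card = n)
    (hy : y ∈ perpSet (L : Set (E → HahnSeries Γ K))) (hyi : y i ≠ 0)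
    (h : ∀ j, j ≠ i → X i + (y i).orderTop < X j + (y j).orderTop) :
    ∃ c, IsCircuitOf (perpSet (L : Set (E → HahnSeries Γ K))) c ∧ c i ≠ 0 ∧ ∀ j, j ≠ i →
      X i + (c i).orderTop < X j + (c j).orderTop := by
  induction n using Nat.strong_induction_on generalizing y with
  | _ n ih =>
  by_cases hcirc : IsCircuitOf (perpSet (L : Set (E → HahnSeries Γ K))) y
  · exact ⟨y, hcirc, hyi, h⟩
  have hy0 : y ≠ 0 := fun hh => hyi (by rw [hh]; rfl)
  unfold IsCircuitOf at hcirc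
  push Not at hcirc
  obtain ⟨z, hz, hz0, hsub, hne⟩ := hcirc hy hy0
  have hss : ∀ j, y j = 0 → z j = 0 := fun j hj => by
    by_contra hh; exact hsub hh hj
  have hfin : X i + (y i).orderTop < ⊤ := by
    rw [lt_top_iff_ne_top, WithTop.add_ne_top]
    exact ⟨hi, HahnSeries.orderTop_ne_top.mpr hyi⟩
  by_cases hzi : z i ≠ 0 ∧ ∀ j, j ≠ i → X i + (z i).orderTop < X j + (z j).orderTop
  · refine ih _ ?_ z rfl hz hzi.1 hzi.2
    rw [← hn]
    refine Finset.card_lt_card (Finset.ssubset_iff_subset_ne.mpr ⟨fun j hj => ?_, fun hh => hne ?_⟩)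
    · simp only [Finset.mem_filter, Finset.mem_univ, true_and] at hj ⊢
      exact hsub hj
    · ext j
      have := Finset.ext_iff.mp hh j
      simpa using this
  -- pick a minimiser other than `i`
  have hk : ∃ k, k ≠ i ∧ z k ≠ 0 ∧ ∀ j, X k + (z k).orderTop ≤ X j + (z j).orderTop := by
    have hS : ∃ k, z k ≠ 0 ∧ ∀ j, X k + (z k).orderTop ≤ X j + (z j).orderTop := by
      obtain ⟨j0, hj0⟩ := Function.ne_iff.mp hz0
      obtain ⟨k, hk, hmin⟩ := Finset.exists_min_image (Finset.univ.filter fun j => z j ≠ 0)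
        (fun j => X j + (z j).orderTop) ⟨j0, by simpa using hj0⟩
      simp only [Finset.mem_filter, Finset.mem_univ, true_and] at hk hmin
      refine ⟨k, hk, fun j => ?_⟩
      by_cases hj : z j = 0
      · simp [hj]
      · exact hmin j hj
    obtain ⟨k, hk, hmin⟩ := hS
    by_cases hki : k = i
    · subst hki
      have : ∃ j, j ≠ k ∧ X j + (z j).orderTop ≤ X k + (z k).orderTop := by
        by_contra hh
        push Not at hh
        exact hzi ⟨hk, hh⟩
      obtain ⟨j, hj, hle⟩ := this
      refine ⟨j, hj, fun h0 => ?_, fun l => hle.trans (hmin l)⟩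
      rw [h0, HahnSeries.orderTop_zero, add_top, top_le_iff, WithTop.add_eq_top] at hle
      rcases hle with hle | hle
      · exact hi hle
      · exact hk (HahnSeries.orderTop_eq_top.mp hle)
    · exact ⟨k, hki, hk, hmin⟩
  obtain ⟨k, hki, hzk, hmin⟩ := hk
  have hlam : ∀ j, X i + (y i).orderTop < X j + (y k / z k * z j).orderTop := by
    intro j
    have e1 : (y k).orderTop = (y k / z k).orderTop + (z k).orderTop := by
      rw [← HahnSeries.orderTop_mul, div_mul_cancel₀ _ hzk]
    rw [HahnSeries.orderTop_mul]
    refine lt_of_lt_of_le (h k hki) ?_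
    rw [e1, add_left_comm, add_left_comm (X j)]
    exact add_le_add_right (hmin j) _
  have hval : (y i - y k / z k * z i).orderTop = (y i).orderTop := by
    refine HahnSeries.orderTop_sub ?_
    exact lt_of_add_lt_add_left (hlam i)
  refine ih _ ?_ (y - (y k / z k) • z) rfl ?_ ?_ ?_
  · rw [← hn]
    refine Finset.card_lt_card (Finset.ssubset_iff_of_subset (fun j hj => ?_) |>.mpr ⟨k, ?_, ?_⟩)
    · simp only [Finset.mem_filter, Finset.mem_univ, true_and] at hj ⊢
      intro h0
      apply hj
      simp [h0, hss j h0]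
    · simp only [Finset.mem_filter, Finset.mem_univ, true_and]
      exact fun h0 => hzk (hss k h0)
    · simp [hzk]
  · intro x hx
    have a1 := hy x hx
    have a2 := hz x hx
    have : ∑ j, x j * (y - (y k / z k) • z) j = ∑ j, x j * y j - (y k / z k) * ∑ j, x j * z j := by
      rw [Finset.mul_sum, ← Finset.sum_sub_distrib]
      refine Finset.sum_congr rfl fun j _ => ?_
      simp only [Pi.sub_apply, Pi.smul_apply, smul_eq_mul]
      ring
    rw [this, a1, a2]; simp
  · simp only [Pi.sub_apply, Pi.smul_apply, smul_eq_mul]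
    rw [← HahnSeries.orderTop_ne_top, hval]
    exact HahnSeries.orderTop_ne_top.mpr hyi
  · intro j hj
    simp only [Pi.sub_apply, Pi.smul_apply, smul_eq_mul]
    rw [hval]
    have : min (X j + (y j).orderTop) (X j + (y k / z k * z j).orderTop)
        ≤ X j + (y j - y k / z k * z j).orderTop := by
      rw [min_add_add_left]
      exact add_le_add_right HahnSeries.min_orderTop_le_orderTop_sub _
    exact lt_of_lt_of_le (lt_min (h j hj) (hlam j)) this

theorem aux_generic [Infinite K] (X : E → WithTop Γ)
    (L : Submodule (HahnSeries Γ K) (E → HahnSeries Γ K))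
    (h : ∀ i, X i ≠ ⊤ → ∃ x ∈ L, (x i).orderTop = X i ∧ ∀ j, X j ≤ (x j).orderTop) :
    ∃ x ∈ L, ∀ j, (x j).orderTop = X j := by
  let M : Submodule K (E → HahnSeries Γ K) :=
    { carrier := {x | x ∈ L ∧ ∀ j, X j ≤ (x j).orderTop}
      zero_mem' := ⟨L.zero_mem, by simp⟩
      add_mem' := fun {x z} hx hz => ⟨L.add_mem hx.1 hz.1, fun j =>
        le_trans (le_min (hx.2 j) (hz.2 j)) HahnSeries.min_orderTop_le_orderTop_add⟩
      smul_mem' := fun a x hx => ⟨by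
        have : a • x = (HahnSeries.C a : HahnSeries Γ K) • x := by
          funext j
          simp [HahnSeries.C_mul_eq_smul]
        rw [this]
        exact L.smul_mem _ hx.1, fun j =>
          le_trans (hx.2 j) (HahnSeries.orderTop_le_orderTop_smul _ _)⟩ }
  let f : {i // X i ≠ ⊤} → Module.Dual K (E → HahnSeries Γ K) := fun i =>
    (HahnSeries.coeff.linearMap ((X i.1).untop i.2)).comp
      (LinearMap.proj (R := K) (φ := fun _ : E => HahnSeries Γ K) i.1)
  obtain ⟨x, hx, hf⟩ := Module.Dual.exists_forall_mem_ne_zero_of_forall_exists M f (by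
    rintro ⟨i, hi⟩
    obtain ⟨x, hx, hxi, hxX⟩ := h i hi
    refine ⟨x, ⟨hx, hxX⟩, ?_⟩
    change (x i).coeff ((X i).untop hi) ≠ 0
    exact HahnSeries.coeff_orderTop_ne (by rw [hxi, WithTop.coe_untop]))
  refine ⟨x, hx.1, fun j => le_antisymm ?_ (hx.2 j)⟩
  by_cases hj : X j = ⊤
  · rw [hj]; exact le_top
  · have h1 : (x j).coeff ((X j).untop hj) ≠ 0 := hf ⟨j, hj⟩
    simpa using HahnSeries.orderTop_le_of_coeff_ne_zero h1
end aux

/-- Let `K` be an infinite field and `L ⊆ K((Γ))^E` a linear subspace. A tuple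
`X ∈ (Γ ∪ {∞})^E` lies in the coordinatewise valuation image of `L` iff for every circuit `c`
of `L^⊥` the minimum over `i` of `X_i + val(c_i)` is either `∞` or attained at least twice. -/
theorem val_image_of_linear_space
    {K : Type*} [Field K] [Infinite K] {Γ : Type*} [AddCommGroup Γ] [LinearOrder Γ] [IsOrderedAddMonoid Γ]
    {E : Type*} [Fintype E]
    (L : Submodule (HahnSeries Γ K) (E → HahnSeries Γ K)) (X : E → WithTop Γ) :
    (∃ x ∈ L, ∀ i : E, (x i).orderTop = X i) ↔
      ∀ c : E → HahnSeries Γ K, IsCircuitOf (perpSet (L : Set (E → HahnSeries Γ K))) c →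
        ∀ i : E, (∀ j : E, X i + (c i).orderTop ≤ X j + (c j).orderTop) →
          (X i + (c i).orderTop = ⊤ ∨
            ∃ i' : E, i' ≠ i ∧ X i' + (c i').orderTop = X i + (c i).orderTop) := by
  constructor
  · rintro ⟨x, hx, hxX⟩ c hc i hmin
    by_contra hcon
    push Not at hcon
    obtain ⟨h1, h2⟩ := hcon
    refine aux_unique_min (fun j => x j * c j) i (fun j hj => ?_) ?_ (hc.1 x hx)
    · simp only [HahnSeries.orderTop_mul, hxX]
      exact lt_of_le_of_ne (hmin j) (Ne.symm (h2 j hj))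
    · simp only [HahnSeries.orderTop_mul, hxX]
      exact lt_top_iff_ne_top.mpr h1
  · intro H
    refine aux_generic X L fun i hi => ?_
    rcases aux_farkas X i hi L with h | ⟨y, hy, hyi, h⟩
    · exact h
    exfalso
    have key : ∃ c, IsCircuitOf (perpSet (L : Set (E → HahnSeries Γ K))) c ∧ c i ≠ 0 ∧ ∀ j, j ≠ i →
        X i + (c i).orderTop < X j + (c j).orderTop := aux_circuit X i L hi _ y rfl hy hyi h
    obtain ⟨c, hc, hci, hlt⟩ := key
    have hm : ∀ j, X i + (c i).orderTop ≤ X j + (c j).orderTop := by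
      intro j
      by_cases hj : j = i
      · rw [hj]
      · exact (hlt j hj).le
    rcases H c hc i hm with h1 | ⟨j, hj, h1⟩
    · rw [WithTop.add_eq_top] at h1
      rcases h1 with h1 | h1
      · exact hi h1
      · exact hci (HahnSeries.orderTop_eq_top.mp h1)
    · exact absurd h1 (hlt j hj).ne'
end

section
/- Let K be a linearly ordered field, Γ a linearly ordered abelian group, E a finite set, and L ⊆ K((Γ))^E a K((Γ))-linear subspace. For f ∈ K((Γ)) write sgn(f) ∈ {+1, −1} for the sign of the leading coefficient lc(f) when f ≠ 0, and sgn(0) = 0. Then a pair (s, X), with s : E → {+1, 0, −1} and X ∈ (Γ∪{∞})^E satisfying s_i = 0 if and only if X_i = ∞, lies in the coordinatewise signed valuation image {((sgn(x_i), val(x_i)))_{i∈E} : x ∈ L} if and only if, for every circuit c of L^⊥: letting m = min_{i∈E}(X_i + val(c_i)) in Γ∪{∞}, either m = ∞ or both +1 and −1 occur among the products s_i·sgn(c_i) over those i ∈ E with X_i + val(c_i) = m. (This is the case ν = sval of the Proposition on tropicalisation: sval(𝒱*(N)) = 𝒱*(sval_*(N)).) -/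
open scoped Classical

def BoxGood {E F : Type*} [Fintype E] [Field F] (I : E → Set F) (y : E → F) : Prop :=
  ∃ x : E → F, (∀ i, x i ∈ I i) ∧ ∑ i, x i * y i = 0

section gen
variable {E F : Type*} [Fintype E] [Field F] [LinearOrder F] [IsStrictOrderedRing F]

lemma BoxGood.smul {I : E → Set F} {y : E → F} (h : BoxGood I y) (a : F) :
    BoxGood I (a • y) := by
  obtain ⟨x, hx, h⟩ := h
  refine ⟨x, hx, ?_⟩
  have : ∑ i, x i * (a • y) i = a * ∑ i, x i * y i := by
    rw [Finset.mul_sum]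
    refine Finset.sum_congr rfl fun i _ => ?_
    simp only [Pi.smul_apply, smul_eq_mul]; ring
  rw [this, h, mul_zero]

lemma BoxGood.add {I : E → Set F} (hI : ∀ i, Convex F (I i)) {y z : E → F}
    (hy : BoxGood I y) (hz : BoxGood I z) (h : ∀ i, 0 ≤ y i * z i) :
    BoxGood I (y + z) := by
  obtain ⟨x, hx, hxy⟩ := hy
  obtain ⟨w, hw, hwz⟩ := hz
  have key : ∀ i, ∃ t ∈ I i, t * (y i + z i) = x i * y i + w i * z i := by
    intro i
    by_cases h0 : y i + z i = 0
    · have hz : z i = - y i := by linear_combination h0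
      have h1 := h i
      have hy0 : y i = 0 := by rw [hz] at h1; nlinarith
      refine ⟨x i, hx i, ?_⟩
      rw [hz, hy0]; ring
    · have hs : 0 < (y i + z i)^2 := by positivity
      have h1 := h i
      refine ⟨(y i / (y i + z i)) • x i + (z i / (y i + z i)) • w i,
        hI i (hx i) (hw i) ?_ ?_ ?_, ?_⟩
      · have : y i / (y i + z i) = (y i * y i + y i * z i) / (y i + z i)^2 := by
          field_simp
        rw [this]
        exact div_nonneg (add_nonneg (mul_self_nonneg _) h1) hs.le
      · have : z i / (y i + z i) = (z i * z i + y i * z i) / (y i + z i)^2 := by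
          field_simp; ring
        rw [this]
        exact div_nonneg (add_nonneg (mul_self_nonneg _) h1) hs.le
      · field_simp
      · simp only [smul_eq_mul]; field_simp
  choose t ht hte using key
  refine ⟨t, ht, ?_⟩
  simp only [Pi.add_apply, hte, Finset.sum_add_distrib, hxy, hwz, add_zero]

lemma conf_reduce (y c : E → F) (h : ∃ i, 0 < c i * y i) :
    ∃ l : F, 0 < l ∧ (∀ i, 0 ≤ (y i - l * c i) * y i) ∧ ∃ j, y j ≠ 0 ∧ y j - l * c j = 0 := by
  classical
  have hne : (Finset.univ.filter (fun i => 0 < c i * y i)).Nonempty := by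
    obtain ⟨i, hi⟩ := h
    exact ⟨i, by simpa using hi⟩
  obtain ⟨j, hj, hmin⟩ := Finset.exists_min_image _ (fun i => y i / c i) hne
  simp only [Finset.mem_filter, Finset.mem_univ, true_and] at hj hmin
  have hcj : c j ≠ 0 := by rintro h; simp [h] at hj
  have hyj : y j ≠ 0 := by rintro h; simp [h] at hj
  have hpos : 0 < y j / c j := by
    have : y j / c j = (c j * y j) / (c j)^2 := by field_simp
    rw [this]; positivity
  refine ⟨y j / c j, hpos, ?_, j, hyj, ?_⟩
  · intro i
    rcases le_or_gt (c i * y i) 0 with hi | hi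
    · nlinarith [mul_self_nonneg (y i), mul_nonneg hpos.le (neg_nonneg.2 hi)]
    · have hm := hmin i hi
      have hci : c i ≠ 0 := by rintro h; simp [h] at hi
      have : (y i - y j / c j * c i) * y i = (y i / c i - y j / c j) * (c i * y i) := by
        field_simp
      rw [this]
      exact mul_nonneg (sub_nonneg.2 hm) hi.le
  · field_simp; ring

lemma good_all {I : E → Set F} (hI : ∀ i, Convex F (I i)) (hne : ∀ i, (I i).Nonempty)
    (N : Submodule F (E → F))
    (hc : ∀ c, IsCircuitOf (N : Set (E → F)) c → BoxGood I c) (y : E → F) (hy : y ∈ N) :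
    BoxGood I y := by
  classical
  induction hn : (Finset.univ.filter (fun i => y i ≠ 0)).card using Nat.strong_induction_on
    generalizing y with
  | _ n ih =>
  have ih' : ∀ z ∈ N, (∀ i, y i = 0 → z i = 0) → (∃ j, y j ≠ 0 ∧ z j = 0) → BoxGood I z := by
    rintro z hz hs ⟨j, hj, hzj⟩
    refine ih _ ?_ z hz rfl
    rw [← hn]
    apply Finset.card_lt_card
    rw [Finset.ssubset_iff_of_subset]
    · exact ⟨j, by simpa using hj, by simpa using hzj⟩
    · intro i hi
      simp only [Finset.mem_filter, Finset.mem_univ, true_and] at hi ⊢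
      exact fun h => hi (hs i h)
  by_cases hy0 : y = 0
  · choose x hx using hne
    exact ⟨x, hx, by simp [hy0]⟩
  by_cases hcirc : IsCircuitOf (N : Set (E → F)) y
  · exact hc y hcirc
  have hex : ∃ c ∈ N, c ≠ 0 ∧ (∀ i, y i = 0 → c i = 0) ∧ ∃ j, y j ≠ 0 ∧ c j = 0 := by
    simp only [IsCircuitOf, not_and, not_forall] at hcirc
    obtain ⟨c, hcN, hc0, hsub, hneq⟩ := hcirc hy hy0
    refine ⟨c, hcN, hc0, fun i hi => by_contra fun h => hsub h hi, ?_⟩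
    by_contra hcon
    push Not at hcon
    exact hneq (Set.Subset.antisymm hsub hcon)
  have hex2 : ∃ c ∈ N, (∃ i, 0 < c i * y i) ∧ (∀ i, y i = 0 → c i = 0) ∧
      ∃ j, y j ≠ 0 ∧ c j = 0 := by
    obtain ⟨c, hcN, hc0, hsub, j, hj, hcj⟩ := hex
    obtain ⟨i, hi⟩ := Function.ne_iff.1 hc0
    have hi : c i ≠ 0 := hi
    have hyi : y i ≠ 0 := fun h => hi (hsub i h)
    rcases lt_or_gt_of_ne (mul_ne_zero hi hyi) with h | h
    · exact ⟨-c, N.neg_mem hcN, ⟨i, by simpa using h⟩, fun i h => by simp [hsub i h],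
        j, hj, by simp [hcj]⟩
    · exact ⟨c, hcN, ⟨i, h⟩, hsub, j, hj, hcj⟩
  obtain ⟨c, hcN, hpos, hsub, hj⟩ := hex2
  have conf : ∀ u v : E → F, (∀ i, y i = 0 → u i = 0) → (∀ i, 0 ≤ u i * y i) →
      (∀ i, 0 ≤ v i * y i) → ∀ i, 0 ≤ u i * v i := by
    intro u v hu hu1 hv1 i
    by_cases h : y i = 0
    · simp [hu i h]
    · have h2 : 0 < y i * y i := mul_self_pos.2 h
      have h3 := mul_nonneg (hu1 i) (hv1 i)
      by_contra hcon
      push Not at hcon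
      nlinarith [mul_neg_of_neg_of_pos hcon h2]
  obtain ⟨l, hl, hl1, j1, hj1, hj1'⟩ := conf_reduce y c hpos
  have g1 : BoxGood I (y - l • c) := by
    apply ih' _ (N.sub_mem hy (N.smul_mem _ hcN))
    · intro i hi; simp [hi, hsub i hi]
    · exact ⟨j1, hj1, by simpa using hj1'⟩
  have s1 : ∀ i, y i = 0 → (y - l • c) i = 0 := by intro i hi; simp [hi, hsub i hi]
  by_cases hneg : ∃ i, 0 < (-c) i * y i
  · obtain ⟨m, hm, hm1, j2, hj2, hj2'⟩ := conf_reduce y (-c) hneg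
    have g2 : BoxGood I (y - m • (-c)) := by
      apply ih' _ (N.sub_mem hy (N.smul_mem _ (N.neg_mem hcN)))
      · intro i hi; simp [hi, hsub i hi]
      · exact ⟨j2, hj2, by simpa using hj2'⟩
    have hlm : 0 < l + m := by positivity
    have := BoxGood.add hI (g1.smul (m / (l + m))) (g2.smul (l / (l + m))) ?_
    · convert this using 1
      ext i
      simp only [Pi.add_apply, Pi.smul_apply, Pi.sub_apply, smul_eq_mul, Pi.neg_apply]
      field_simp
      ring
    · intro i
      have := conf (y - l • c) (y - m • (-c)) s1 (by simpa using hl1) (by simpa using hm1) i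
      have h2 : 0 ≤ (m / (l + m)) * (l / (l + m)) := by positivity
      have h3 := mul_nonneg h2 this
      simp only [Pi.smul_apply, smul_eq_mul] at h3 ⊢
      linarith
  · push Not at hneg
    have gc : BoxGood I c := ih' c hcN hsub hj
    have := BoxGood.add hI g1 (gc.smul l) ?_
    · simpa using this
    · refine conf _ _ s1 (by simpa using hl1) ?_
      intro i
      have := hneg i
      simp only [Pi.smul_apply, smul_eq_mul, Pi.neg_apply] at this ⊢
      nlinarith

lemma helly_line {ι : Type*} (s : Finset ι) (J : ι → Set F) (hJ : ∀ i ∈ s, Convex F (J i))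
    (h : ∀ i ∈ s, ∀ j ∈ s, (J i ∩ J j).Nonempty) : ∃ z, ∀ i ∈ s, z ∈ J i := by
  classical
  have := Convex.helly_theorem' (𝕜 := F) (F := J) (s := s) hJ ?_
  · obtain ⟨z, hz⟩ := this
    exact ⟨z, by simpa using hz⟩
  · intro I hI hcard
    simp only [Module.finrank_self] at hcard
    rcases I.eq_empty_or_nonempty with rfl | ⟨a, ha⟩
    · simp
    · have hc : (I.erase a).card ≤ 1 := by
        rw [Finset.card_erase_of_mem ha]; omega
      rcases (I.erase a).eq_empty_or_nonempty with h0 | ⟨b, hb⟩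
      · obtain ⟨z, hz⟩ := h a (hI ha) a (hI ha)
        refine ⟨z, ?_⟩
        simp only [Set.mem_iInter]
        intro i hi
        by_cases hia : i = a
        · rw [hia]; exact hz.1
        · have : i ∈ I.erase a := Finset.mem_erase.2 ⟨hia, hi⟩
          simp [h0] at this
      · obtain ⟨z, hz⟩ := h a (hI ha) b (hI (Finset.mem_of_mem_erase hb))
        refine ⟨z, ?_⟩
        simp only [Set.mem_iInter]
        intro i hi
        by_cases hia : i = a
        · rw [hia]; exact hz.1
        · have : i ∈ I.erase a := Finset.mem_erase.2 ⟨hia, hi⟩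
          rw [Finset.card_le_one.1 hc i this b hb]; exact hz.2

lemma circuit_smul {N : Submodule F (E → F)} {c : E → F}
    (hc : IsCircuitOf (N : Set (E → F)) c) {a : F} (ha : a ≠ 0) :
    IsCircuitOf (N : Set (E → F)) (a • c) := by
  obtain ⟨h1, h2, h3⟩ := hc
  refine ⟨N.smul_mem a h1, smul_ne_zero ha h2, ?_⟩
  have : {i | (a • c) i ≠ 0} = {i | c i ≠ 0} := by ext i; simp [ha]
  rw [this]; exact h3

lemma box_step {I : E → Set F} (hI : ∀ i, Convex F (I i)) (hne : ∀ i, (I i).Nonempty)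
    (N : Submodule F (E → F))
    (hc : ∀ c, IsCircuitOf (N : Set (E → F)) c → BoxGood I c) (e : E) :
    ∃ z ∈ I e, ∀ c, IsCircuitOf (N : Set (E → F)) c →
      BoxGood (Function.update I e {z}) c := by
  classical
  have hall := good_all hI hne N hc
  let C : Set (E → F) := {c | IsCircuitOf (N : Set (E → F)) c ∧ c e = -1}
  have hfin : C.Finite := by
    apply Set.Finite.of_finite_image (f := fun c : E → F => {i | c i ≠ 0}) (Set.toFinite _)
    rintro c ⟨hc1, hc2⟩ d ⟨hd1, hd2⟩ hcd
    by_contra hne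
    have hcd : {i | c i ≠ 0} = {i | d i ≠ 0} := hcd
    have hsub : {i | (c - d) i ≠ 0} ⊆ {i | c i ≠ 0} := by
      intro i hi hci
      have hdi : d i = 0 := by
        by_contra hdi
        have : i ∈ {i | c i ≠ 0} := hcd ▸ hdi
        exact this hci
      exact hi (by simp [hci, hdi])
    have := hc1.2.2 (c - d) (N.sub_mem hc1.1 hd1.1) (sub_ne_zero.2 hne) hsub
    have he : e ∈ {i | (c - d) i ≠ 0} := by rw [this]; simp [hc2]
    exact he (by simp [hc2, hd2])
  -- the set of admissible values
  let J : Option (E → F) → Set F := fun o => o.elim (I e)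
    (fun c => {z | ∃ x : E → F, (∀ i, x i ∈ I i) ∧ z = ∑ i ∈ Finset.univ.erase e, x i * c i})
  have hsum : ∀ (x c : E → F), ∑ i, x i * c i = x e * c e +
      ∑ i ∈ Finset.univ.erase e, x i * c i := fun x c =>
    (Finset.add_sum_erase _ _ (Finset.mem_univ e)).symm
  have hconv : ∀ o, Convex F (J o) := by
    rintro (_ | c)
    · exact hI e
    · rintro _ ⟨x, hx, rfl⟩ _ ⟨x', hx', rfl⟩ a b ha hb hab
      refine ⟨fun i => a • x i + b • x' i, fun i => hI i (hx i) (hx' i) ha hb hab, ?_⟩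
      simp only [smul_eq_mul, Finset.mul_sum, ← Finset.sum_add_distrib]
      exact Finset.sum_congr rfl fun i _ => by ring
  have hIJ : ∀ c ∈ C, ∃ z, z ∈ I e ∧ z ∈ J (some c) := by
    rintro c ⟨hc1, hc2⟩
    obtain ⟨x, hx, h⟩ := hc c hc1
    refine ⟨x e, hx e, x, hx, ?_⟩
    rw [hsum, hc2] at h
    linear_combination -h
  have hJJ : ∀ c ∈ C, ∀ d ∈ C, (J (some c) ∩ J (some d)).Nonempty := by
    rintro c ⟨hc1, hc2⟩ d ⟨hd1, hd2⟩
    obtain ⟨x, hx, h⟩ := hall (c - d) (N.sub_mem hc1.1 hd1.1)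
    refine ⟨_, ⟨x, hx, rfl⟩, x, hx, ?_⟩
    rw [hsum] at h
    simp only [Pi.sub_apply, hc2, hd2, mul_sub, Finset.sum_sub_distrib] at h
    linear_combination h
  obtain ⟨z, hz⟩ := helly_line (insert none (hfin.toFinset.image some)) J
    (fun o _ => hconv o) (by
      intro a ha b hb
      simp only [Finset.mem_insert, Finset.mem_image, Set.Finite.mem_toFinset] at ha hb
      rcases ha with rfl | ⟨c, hcC, rfl⟩ <;> rcases hb with rfl | ⟨d, hdC, rfl⟩
      · rw [Set.inter_self]; exact hne e
      · obtain ⟨z, h1, h2⟩ := hIJ d hdC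
        exact ⟨z, h1, h2⟩
      · obtain ⟨z, h1, h2⟩ := hIJ c hcC
        exact ⟨z, h2, h1⟩
      · exact hJJ c hcC d hdC)
  have hupd : ∀ x : E → F, (∀ i, x i ∈ I i) → ∀ i, Function.update x e z i ∈
      Function.update I e {z} i := by
    intro x hx i
    by_cases h : i = e
    · subst h; simp
    · simp [h, hx i]
  have hupds : ∀ x c : E → F, ∑ i, Function.update x e z i * c i =
      z * c e + ∑ i ∈ Finset.univ.erase e, x i * c i := by
    intro x c
    rw [hsum]
    congr 1
    · simp
    · refine Finset.sum_congr rfl fun i hi => ?_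
      simp [Finset.ne_of_mem_erase hi]
  refine ⟨z, hz none (by simp), fun c hcc => ?_⟩
  by_cases hce : c e = 0
  · obtain ⟨x, hx, h⟩ := hc c hcc
    refine ⟨_, hupd x hx, ?_⟩
    rw [hupds]
    rw [hsum] at h
    rw [← h, hce]; ring
  · have ha : -(c e)⁻¹ ≠ 0 := neg_ne_zero.2 (inv_ne_zero hce)
    have hC : (-(c e)⁻¹) • c ∈ C := ⟨circuit_smul hcc ha, by simp [hce]⟩
    obtain ⟨x, hx, h⟩ := hz (some _) (by
      simp only [Finset.mem_insert, Finset.mem_image, Set.Finite.mem_toFinset]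
      exact Or.inr ⟨_, hC, rfl⟩)
    have : BoxGood (Function.update I e {z}) ((-(c e)⁻¹) • c) := by
      refine ⟨_, hupd x hx, ?_⟩
      rw [hupds, ← h]
      simp [hce]
    have h2 := this.smul (-(c e))
    rw [smul_smul] at h2
    simpa [hce] using h2

lemma box_main {I : E → Set F} (hI : ∀ i, Convex F (I i)) (hne : ∀ i, (I i).Nonempty)
    (N : Submodule F (E → F))
    (hc : ∀ c, IsCircuitOf (N : Set (E → F)) c → BoxGood I c) :
    ∃ x : E → F, (∀ i, x i ∈ I i) ∧ ∀ y ∈ N, ∑ i, x i * y i = 0 := by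
  classical
  have key : ∀ S : Finset E, ∃ I' : E → Set F, (∀ i, Convex F (I' i)) ∧ (∀ i, (I' i).Nonempty) ∧
      (∀ i, I' i ⊆ I i) ∧ (∀ i ∈ S, ∃ z, I' i = {z}) ∧
      ∀ c, IsCircuitOf (N : Set (E → F)) c → BoxGood I' c := by
    intro S
    induction S using Finset.induction_on with
    | empty => exact ⟨I, hI, hne, fun _ => subset_rfl, by simp, hc⟩
    | insert e S he ih =>
      obtain ⟨I', h1, h2, h3, h4, h5⟩ := ih
      obtain ⟨z, hz, hzc⟩ := box_step h1 h2 N h5 e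
      refine ⟨Function.update I' e {z}, ?_, ?_, ?_, ?_, hzc⟩
      · intro i
        by_cases h : i = e
        · subst h; simp [convex_singleton]
        · simp [h, h1 i]
      · intro i
        by_cases h : i = e
        · subst h; simp
        · simp [h, h2 i]
      · intro i
        by_cases h : i = e
        · subst h; simpa using h3 i hz
        · simp [h, h3 i]
      · intro i hi
        by_cases h : i = e
        · subst h; exact ⟨z, by simp⟩
        · simpa [h] using h4 i ((Finset.mem_insert.1 hi).resolve_left h)
  obtain ⟨I', h1, h2, h3, h4, h5⟩ := key Finset.univ
  choose x hx using fun i => h4 i (Finset.mem_univ i)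
  refine ⟨x, fun i => h3 i (by rw [hx i]; rfl), fun y hy => ?_⟩
  obtain ⟨x', hx', h⟩ := good_all h1 h2 N h5 y hy
  have : x' = x := by
    ext i
    have := hx' i
    rw [hx i] at this
    exact this
  rwa [this] at h

lemma mem_of_perp {E F : Type*} [Fintype E] [Field F] (L : Submodule F (E → F)) (z : E → F)
    (h : ∀ y : E → F, (∀ x ∈ L, ∑ i, x i * y i = 0) → ∑ i, z i * y i = 0) : z ∈ L := by
  classical
  by_contra hz
  obtain ⟨f, hf, hL⟩ := Submodule.exists_le_ker_of_notMem hz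
  have hfe : ∀ x : E → F, f x = ∑ i, x i * f (Pi.single i 1) := by
    intro x
    conv_lhs => rw [← Finset.univ_sum_single x, map_sum]
    refine Finset.sum_congr rfl fun i _ => ?_
    rw [← smul_eq_mul, ← map_smul, ← Pi.single_smul, smul_eq_mul, mul_one]
  apply hf
  rw [hfe]
  apply h
  intro x hx
  rw [← hfe]
  exact hL hx

end gen

section hahn
variable {K : Type*} [Field K] [LinearOrder K] [IsStrictOrderedRing K]
  {Γ : Type*} [AddCommGroup Γ] [LinearOrder Γ] [IsOrderedAddMonoid Γ]

@[reducible] noncomputable def hahnLO (K : Type*) [Field K] [LinearOrder K]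
    [IsStrictOrderedRing K] (Γ : Type*) [AddCommGroup Γ] [LinearOrder Γ]
    [IsOrderedAddMonoid Γ] : LinearOrder (HahnSeries Γ K) :=
  inferInstanceAs (LinearOrder (Lex (HahnSeries Γ K)))

attribute [local instance] hahnLO

lemma hahnSO : IsStrictOrderedRing (HahnSeries Γ K) :=
  inferInstanceAs (IsStrictOrderedRing (Lex (HahnSeries Γ K)))

attribute [local instance] hahnSO

lemma hahn_pos (f : HahnSeries Γ K) : 0 < f.leadingCoeff ↔ 0 < f :=
  HahnSeries.leadingCoeff_pos_iff (x := toLex f)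

lemma hahn_neg (f : HahnSeries Γ K) : f.leadingCoeff < 0 ↔ f < 0 :=
  HahnSeries.leadingCoeff_neg_iff (x := toLex f)

lemma hahn_sign (f : HahnSeries Γ K) : SignType.sign f.leadingCoeff = SignType.sign f := by
  rcases lt_trichotomy f 0 with h | h | h
  · rw [sign_neg h, sign_neg ((hahn_neg f).2 h)]
  · simp [h]
  · rw [sign_pos h, sign_pos ((hahn_pos f).2 h)]

lemma hahn_abs {f g : HahnSeries Γ K} (h : |f| ≤ |g|) : g.orderTop ≤ f.orderTop := by
  by_contra hc
  push Not at hc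
  exact absurd (HahnSeries.abs_lt_abs_of_orderTop_ofLex (x := toLex g) (y := toLex f) hc)
    (not_lt.2 h)

def svSet (s : SignType) (X : WithTop Γ) : Set (HahnSeries Γ K) :=
  {f | SignType.sign f.leadingCoeff = s ∧ f.orderTop = X}

lemma svSet_convex (s : SignType) (X : WithTop Γ) :
    Convex (HahnSeries Γ K) (svSet (K := K) s X) := by
  apply Set.OrdConnected.convex
  refine ⟨?_⟩
  rintro f ⟨hf, hfX⟩ k ⟨hk, hkX⟩ h ⟨h1, h2⟩
  rw [hahn_sign] at hf hk
  rcases s.trichotomy with hs | hs | hs <;> subst hs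
  · rw [sign_eq_neg_one_iff] at hf hk
    have hh : h < 0 := lt_of_le_of_lt h2 hk
    refine ⟨by rw [hahn_sign, sign_neg hh], le_antisymm ?_ ?_⟩
    · rw [← hkX]; apply hahn_abs
      rw [abs_of_neg hk, abs_of_neg hh]; exact neg_le_neg h2
    · rw [← hfX]; apply hahn_abs
      rw [abs_of_neg hf, abs_of_neg hh]; exact neg_le_neg h1
  · rw [sign_eq_zero_iff] at hf hk
    have : h = f := le_antisymm (by rw [hf, ← hk]; exact h2) h1
    rw [this]
    exact ⟨by simp [hf], hfX⟩
  · rw [sign_eq_one_iff] at hf hk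
    have hh : 0 < h := lt_of_lt_of_le hf h1
    refine ⟨by rw [hahn_sign, sign_pos hh], le_antisymm ?_ ?_⟩
    · rw [← hfX]; apply hahn_abs
      rw [abs_of_pos hf, abs_of_pos hh]; exact h1
    · rw [← hkX]; apply hahn_abs
      rw [abs_of_pos hk, abs_of_pos hh]; exact h2

lemma svSet_nonempty (s : SignType) (X : WithTop Γ) (h : s = 0 ↔ X = ⊤) :
    (svSet (K := K) s X).Nonempty := by
  induction X using WithTop.recTopCoe with
  | top => exact ⟨0, by simp [h.2 rfl], by simp⟩
  | coe g =>
    have hs : s ≠ 0 := fun h0 => by simpa using h.1 h0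
    rcases s.trichotomy with rfl | rfl | rfl
    · exact ⟨HahnSeries.single g (-1), by rw [HahnSeries.leadingCoeff_of_single]; simp,
        HahnSeries.orderTop_single (by simp)⟩
    · exact absurd rfl hs
    · exact ⟨HahnSeries.single g 1, by simp, by simp⟩

lemma hahn_sub {p S : HahnSeries Γ K} (hpS : p * S ≤ 0) (ho : p.orderTop ≤ S.orderTop)
    (hp : p ≠ 0) :
    SignType.sign (p - S).leadingCoeff = SignType.sign p.leadingCoeff ∧
      (p - S).orderTop = p.orderTop := by
  have h1 : p.orderTop ≤ (p - S).orderTop := by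
    rw [sub_eq_add_neg]
    refine le_trans ?_ HahnSeries.min_orderTop_le_orderTop_add
    rw [HahnSeries.orderTop_neg]
    exact le_min le_rfl ho
  rw [hahn_sign, hahn_sign]
  rcases lt_or_gt_of_ne hp with h | h
  · have hS : 0 ≤ S := by
      by_contra hc; push Not at hc
      exact absurd hpS (not_le.2 (mul_pos_of_neg_of_neg h hc))
    have h2 : p - S < 0 := by linarith
    refine ⟨by rw [sign_neg h, sign_neg h2], le_antisymm ?_ h1⟩
    apply hahn_abs
    rw [abs_of_neg h, abs_of_neg h2]; linarith
  · have hS : S ≤ 0 := by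
      by_contra hc; push Not at hc
      exact absurd hpS (not_le.2 (mul_pos h hc))
    have h2 : 0 < p - S := by linarith
    refine ⟨by rw [sign_pos h, sign_pos h2], le_antisymm ?_ h1⟩
    apply hahn_abs
    rw [abs_of_pos h, abs_of_pos h2]; linarith

variable {E : Type*} [Fintype E]

lemma good_fix {s : E → SignType} {X : E → WithTop Γ} (x c : E → HahnSeries Γ K)
    (hx : ∀ i, x i ∈ svSet (s i) (X i)) (k : E) (hk : x k * c k ≠ 0)
    (hmin : ∀ j, (x k * c k).orderTop ≤ (x j * c j).orderTop)
    (hS : (x k * c k) * (∑ i, x i * c i) ≤ 0) :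
    BoxGood (fun i => svSet (K := K) (s i) (X i)) c := by
  classical
  have hck : c k ≠ 0 := right_ne_zero_of_mul hk
  have ho : (x k * c k).orderTop ≤ (∑ i, x i * c i).orderTop := by
    rw [HahnSeries.le_orderTop_iff_forall]
    intro j hj
    rw [HahnSeries.coeff_sum]
    exact Finset.sum_eq_zero fun i _ =>
      HahnSeries.coeff_eq_zero_of_lt_orderTop (lt_of_lt_of_le hj (hmin i))
  obtain ⟨h1, h2⟩ := hahn_sub hS ho hk
  set S := ∑ i, x i * c i with hSdef
  have hmul : (x k - S / c k) * c k = x k * c k - S := by field_simp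
  refine ⟨Function.update x k (x k - S / c k), ?_, ?_⟩
  · intro i
    by_cases hi : i = k
    · subst hi
      simp only [Function.update_self]
      rw [← hmul] at h1 h2
      rw [HahnSeries.leadingCoeff_mul, HahnSeries.leadingCoeff_mul, sign_mul, sign_mul] at h1
      rw [HahnSeries.orderTop_mul, HahnSeries.orderTop_mul] at h2
      refine ⟨?_, ?_⟩
      · rw [← (hx i).1]
        have hs : SignType.sign (c i).leadingCoeff ≠ 0 := by
          simpa [sign_eq_zero_iff] using hck
        exact mul_right_cancel₀ hs h1
      · rw [← (hx i).2]
        exact WithTop.add_right_cancel (HahnSeries.orderTop_ne_top.2 hck) h2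
    · simpa [hi] using hx i
  · have e1 : ∀ z : E → HahnSeries Γ K, ∑ i, z i * c i = z k * c k +
        ∑ i ∈ Finset.univ.erase k, z i * c i := fun z =>
      (Finset.add_sum_erase _ _ (Finset.mem_univ k)).symm
    rw [e1, Function.update_self, hmul]
    have e2 : ∑ i ∈ Finset.univ.erase k, Function.update x k (x k - S / c k) i * c i =
        ∑ i ∈ Finset.univ.erase k, x i * c i := by
      refine Finset.sum_congr rfl fun i hi => ?_
      simp [Finset.ne_of_mem_erase hi]
    have e3 := e1 x
    rw [e2]
    rw [← hSdef] at e3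
    linear_combination -e3

lemma sval_backward
    (L : Submodule (HahnSeries Γ K) (E → HahnSeries Γ K))
    (s : E → SignType) (X : E → WithTop Γ)
    (hsX : ∀ i : E, s i = 0 ↔ X i = ⊤)
    (H : ∀ c : E → HahnSeries Γ K, IsCircuitOf (perpSet (L : Set (E → HahnSeries Γ K))) c →
        ((∀ i : E, X i + (c i).orderTop = ⊤) ∨
          ((∃ i : E, (∀ j : E, X i + (c i).orderTop ≤ X j + (c j).orderTop) ∧
              s i * SignType.sign ((c i).leadingCoeff) = 1) ∧
           (∃ i : E, (∀ j : E, X i + (c i).orderTop ≤ X j + (c j).orderTop) ∧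
              s i * SignType.sign ((c i).leadingCoeff) = -1)))) :
    ∃ x ∈ L, ∀ i : E,
        SignType.sign ((x i).leadingCoeff) = s i ∧ (x i).orderTop = X i := by
  let N : Submodule (HahnSeries Γ K) (E → HahnSeries Γ K) :=
    { carrier := perpSet (L : Set (E → HahnSeries Γ K))
      add_mem' := by
        intro a b ha hb x hx
        simp only [Pi.add_apply, mul_add, Finset.sum_add_distrib, ha x hx, hb x hx, add_zero]
      zero_mem' := by intro x hx; simp
      smul_mem' := by
        intro r a ha x hx
        have : ∑ i, x i * (r • a) i = r * ∑ i, x i * a i := by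
          rw [Finset.mul_sum]
          refine Finset.sum_congr rfl fun i _ => ?_
          simp only [Pi.smul_apply, smul_eq_mul]; ring
        rw [this, ha x hx, mul_zero] }
  have hne : ∀ i, (svSet (K := K) (s i) (X i)).Nonempty := fun i => svSet_nonempty _ _ (hsX i)
  obtain ⟨x, hx, hxN⟩ := box_main (I := fun i => svSet (K := K) (s i) (X i))
    (fun i => svSet_convex _ _) hne N (by
      intro c hc
      choose x hx using hne
      have ho : ∀ i, (x i * c i).orderTop = X i + (c i).orderTop := fun i => by
        rw [HahnSeries.orderTop_mul, (hx i).2]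
      have hsg : ∀ i, SignType.sign (x i * c i) =
          s i * SignType.sign ((c i).leadingCoeff) := fun i => by
        rw [← hahn_sign, HahnSeries.leadingCoeff_mul, sign_mul, (hx i).1]
      rcases H c hc with h | ⟨⟨i, hi, hi1⟩, ⟨k, hk, hk1⟩⟩
      · refine ⟨x, hx, Finset.sum_eq_zero fun i _ => ?_⟩
        rw [← HahnSeries.orderTop_eq_top, ho, h]
      · rw [← hsg, sign_eq_one_iff] at hi1
        rw [← hsg, sign_eq_neg_one_iff] at hk1
        rcases le_total (∑ i, x i * c i) 0 with h | h
        · exact good_fix x c hx i hi1.ne' (fun j => by rw [ho, ho]; exact hi j)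
            (mul_nonpos_of_nonneg_of_nonpos hi1.le h)
        · exact good_fix x c hx k hk1.ne (fun j => by rw [ho, ho]; exact hk j)
            (mul_nonpos_of_nonpos_of_nonneg hk1.le h))
  exact ⟨x, mem_of_perp L x fun y hy => hxN y hy, hx⟩

lemma sval_forward
    (L : Submodule (HahnSeries Γ K) (E → HahnSeries Γ K))
    (x : E → HahnSeries Γ K) (hx : x ∈ L) (c : E → HahnSeries Γ K)
    (hc : c ∈ perpSet (L : Set (E → HahnSeries Γ K))) :
    (∀ i : E, (x i * c i).orderTop = ⊤) ∨
          ((∃ i : E, (∀ j : E, (x i * c i).orderTop ≤ (x j * c j).orderTop) ∧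
              SignType.sign ((x i * c i).leadingCoeff) = 1) ∧
           (∃ i : E, (∀ j : E, (x i * c i).orderTop ≤ (x j * c j).orderTop) ∧
              SignType.sign ((x i * c i).leadingCoeff) = -1)) := by
  by_cases hall : ∀ i : E, (x i * c i).orderTop = ⊤
  · exact Or.inl hall
  right
  push Not at hall
  obtain ⟨i0, hi0⟩ := hall
  obtain ⟨m, -, hm⟩ := Finset.exists_min_image Finset.univ (fun i => (x i * c i).orderTop)
    ⟨i0, Finset.mem_univ _⟩
  have hmt : (x m * c m).orderTop ≠ ⊤ := fun h => hi0 (top_le_iff.1 (h ▸ hm i0 (Finset.mem_univ _)))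
  obtain ⟨g, hg⟩ := WithTop.ne_top_iff_exists.1 hmt
  have hsum : ∑ i, (x i * c i).coeff g = 0 := by
    rw [← HahnSeries.coeff_sum, hc x hx, HahnSeries.coeff_zero]
  have hnz : (x m * c m).coeff g ≠ 0 := HahnSeries.coeff_orderTop_ne hg.symm
  have key : ∀ i, (x i * c i).coeff g ≠ 0 →
      (∀ j : E, (x i * c i).orderTop ≤ (x j * c j).orderTop) ∧
        (x i * c i).leadingCoeff = (x i * c i).coeff g := by
    intro i hi
    have h1 := HahnSeries.orderTop_le_of_coeff_ne_zero hi
    have h2 : (x i * c i).orderTop = g :=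
      le_antisymm h1 (hg ▸ hm i (Finset.mem_univ _))
    refine ⟨fun j => by rw [h2, hg]; exact hm j (Finset.mem_univ _), ?_⟩
    simp [HahnSeries.leadingCoeff, h2]
  obtain ⟨i, -, hi⟩ := Finset.exists_pos_of_sum_zero_of_exists_nonzero
    (fun i => (x i * c i).coeff g) hsum ⟨m, Finset.mem_univ _, hnz⟩
  obtain ⟨k, -, hk⟩ := Finset.exists_pos_of_sum_zero_of_exists_nonzero
    (fun i => - (x i * c i).coeff g) (by simp [hsum]) ⟨m, Finset.mem_univ _, neg_ne_zero.2 hnz⟩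
  have hk : (x k * c k).coeff g < 0 := neg_pos.1 hk
  refine ⟨⟨i, (key i hi.ne').1, ?_⟩, ⟨k, (key k hk.ne).1, ?_⟩⟩
  · rw [(key i hi.ne').2, sign_pos hi]
  · rw [(key k hk.ne).2, sign_neg hk]

end hahn

/-- Let `K` be a linearly ordered field and `L ⊆ K((Γ))^E` a linear subspace.
A pair `(s, X)` with `s_i = 0 ↔ X_i = ∞` lies in the coordinatewise signed valuation image of
`L` iff for every circuit `c` of `L^⊥`, letting `m = min_i (X_i + val(c_i))`, either `m = ∞`
or both `+1` and `-1` occur among the products `s_i · sgn(c_i)` over the minimisers. -/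
theorem sval_image_of_linear_space
    {K : Type*} [Field K] [LinearOrder K] [IsStrictOrderedRing K] {Γ : Type*} [AddCommGroup Γ] [LinearOrder Γ] [IsOrderedAddMonoid Γ]
    {E : Type*} [Fintype E]
    (L : Submodule (HahnSeries Γ K) (E → HahnSeries Γ K))
    (s : E → SignType) (X : E → WithTop Γ)
    (hsX : ∀ i : E, s i = 0 ↔ X i = ⊤) :
    (∃ x ∈ L, ∀ i : E,
        SignType.sign ((x i).leadingCoeff) = s i ∧ (x i).orderTop = X i) ↔
      ∀ c : E → HahnSeries Γ K, IsCircuitOf (perpSet (L : Set (E → HahnSeries Γ K))) c →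
        ((∀ i : E, X i + (c i).orderTop = ⊤) ∨
          ((∃ i : E, (∀ j : E, X i + (c i).orderTop ≤ X j + (c j).orderTop) ∧
              s i * SignType.sign ((c i).leadingCoeff) = 1) ∧
           (∃ i : E, (∀ j : E, X i + (c i).orderTop ≤ X j + (c j).orderTop) ∧
              s i * SignType.sign ((c i).leadingCoeff) = -1))) := by
  constructor
  · rintro ⟨x, hx, hxs⟩ c hc
    have := sval_forward L x hx c hc.1
    simpa only [HahnSeries.orderTop_mul, HahnSeries.leadingCoeff_mul, sign_mul,
      (hxs _).1, (hxs _).2] using this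
  · exact sval_backward L s X hsX
end

section
/- Let K be an infinite field, Γ a linearly ordered abelian group, E a finite set, and L ⊆ K((Γ))^E a K((Γ))-linear subspace. Then a pair (a, X), with a : E → K and X ∈ (Γ∪{∞})^E satisfying a_i = 0 if and only if X_i = ∞, lies in the coordinatewise fine valuation image {((lc(x_i), val(x_i)))_{i∈E} : x ∈ L} if and only if, for every circuit c of L^⊥: Σ_{i∈S} a_i·lc(c_i) = 0 in K, where S = {i ∈ E : X_i + val(c_i) ≠ ∞ and X_i + val(c_i) ≤ X_j + val(c_j) for all j ∈ E} (the empty sum being 0). (This is the case ν = fval, the fine valuation recording leading terms of Hahn series, of the Proposition on tropicalisation: fval(𝒱*(N)) = 𝒱*(fval_*(N)).) -/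
open scoped Classical

lemma fv_coeff_le {K : Type*} [Field K] {Γ : Type*} [LinearOrder Γ]
    (f : HahnSeries Γ K) (g : Γ) (h : (g : WithTop Γ) ≤ f.orderTop) :
    f.coeff g = if f.orderTop = g then f.leadingCoeff else 0 := by
  split_ifs with h1
  · simp [HahnSeries.leadingCoeff, h1]
  · exact HahnSeries.coeff_eq_zero_of_lt_orderTop (lt_of_le_of_ne h (Ne.symm h1))

lemma fv_sum_coeff {K : Type*} [Field K] {Γ : Type*} [LinearOrder Γ]
    {E : Type*} [Fintype E] (y : E → HahnSeries Γ K) (g : Γ) (i0 : E)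
    (h0 : (y i0).orderTop = g) (h : ∀ j, (g : WithTop Γ) ≤ (y j).orderTop) :
    (∑ i, y i).coeff g = ∑ i ∈ Finset.univ.filter (fun i : E =>
      (y i).orderTop ≠ ⊤ ∧ ∀ j : E, (y i).orderTop ≤ (y j).orderTop), (y i).leadingCoeff := by
  rw [HahnSeries.coeff_sum, Finset.sum_filter]
  refine Finset.sum_congr rfl fun i _ => ?_
  rw [fv_coeff_le _ _ (h i)]
  have : ((y i).orderTop = g) ↔
      ((y i).orderTop ≠ ⊤ ∧ ∀ j : E, (y i).orderTop ≤ (y j).orderTop) := by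
    constructor
    · intro hi
      rw [hi]
      exact ⟨WithTop.coe_ne_top, h⟩
    · rintro ⟨_, h2⟩
      exact le_antisymm (h0 ▸ h2 i0) (h i)
  simp only [this]

lemma fv_pivot {K : Type*} [Field K] {Γ : Type*} [AddCommGroup Γ] [LinearOrder Γ]
    [IsOrderedAddMonoid Γ] {E : Type*} [Fintype E] (X : E → WithTop Γ)
    (w : E → HahnSeries Γ K) (hw : w ≠ 0) :
    ∃ i, w i ≠ 0 ∧ ∀ k, X k + (w i).orderTop ≤ (w k).orderTop + X i := by
  by_cases hT : ∃ i, w i ≠ 0 ∧ X i = ⊤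
  · obtain ⟨i, hi, hX⟩ := hT
    exact ⟨i, hi, fun k => by simp [hX]⟩
  · push Not at hT
    have hne : (Finset.univ.filter (fun i => w i ≠ 0)).Nonempty := by
      obtain ⟨i, hi⟩ := Function.ne_iff.mp hw
      exact ⟨i, by simpa using hi⟩
    obtain ⟨i, hi, hmin⟩ := Finset.exists_min_image _
      (fun i => (w i).order - (X i).untopD 0) hne
    have hi' : w i ≠ 0 := by simpa using hi
    refine ⟨i, hi', fun k => ?_⟩
    by_cases hk : w k = 0
    · simp [hk]
    · have h1 := hmin k (by simpa using hk)
      have h2 := hT k hk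
      have h3 := hT i hi'
      rw [← HahnSeries.order_eq_orderTop_of_ne_zero hk,
        ← HahnSeries.order_eq_orderTop_of_ne_zero hi']
      generalize X k = p at *
      generalize X i = q at *
      lift p to Γ using h2
      lift q to Γ using h3
      simp only [WithTop.untopD_coe] at h1
      rw [sub_le_sub_iff] at h1
      rw [add_comm]
      exact_mod_cast h1

lemma fv_le_sum {K : Type*} [Field K] {Γ : Type*} [LinearOrder Γ]
    {E : Type*} (s : Finset E) (y : E → HahnSeries Γ K) (g : WithTop Γ)
    (h : ∀ j ∈ s, g ≤ (y j).orderTop) : g ≤ (∑ i ∈ s, y i).orderTop := by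
  rw [HahnSeries.le_orderTop_iff_forall]
  intro j hj
  rw [HahnSeries.coeff_sum]
  exact Finset.sum_eq_zero fun i hi =>
    HahnSeries.coeff_eq_zero_of_lt_orderTop (lt_of_lt_of_le hj (h i hi))

lemma fv_basis {K : Type*} [Field K] {Γ : Type*} [AddCommGroup Γ] [LinearOrder Γ]
    [IsOrderedAddMonoid Γ] {E : Type*} [Fintype E]
    (L : Submodule (HahnSeries Γ K) (E → HahnSeries Γ K)) (X : E → WithTop Γ) :
    ∃ (J : Finset E) (v : E → E → HahnSeries Γ K), (∀ j ∈ J, v j ∈ L) ∧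
      (∀ j ∈ J, ∀ k ∈ J, v j k = if k = j then 1 else 0) ∧
      (∀ j ∈ J, ∀ k, X k ≤ (v j k).orderTop + X j) ∧
      ∀ x ∈ L, (∀ j ∈ J, x j = 0) → x = 0 := by
  let P : Set (Finset E) := {J | ∃ (v : E → E → HahnSeries Γ K), (∀ j ∈ J, v j ∈ L) ∧
      (∀ j ∈ J, ∀ k ∈ J, v j k = if k = j then 1 else 0) ∧
      (∀ j ∈ J, ∀ k, X k ≤ (v j k).orderTop + X j)}
  have hP : P.Nonempty := ⟨∅, 0, by simp⟩
  obtain ⟨J, ⟨v, hL, hd, hX⟩, hmax⟩ := (Set.toFinite P).exists_maximal hP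
  refine ⟨J, v, hL, hd, hX, fun w hw hwJ => ?_⟩
  by_contra hne
  obtain ⟨i, hi, hpiv⟩ := fv_pivot X w hne
  have hiJ : i ∉ J := fun h => hi (hwJ i h)
  let u : E → HahnSeries Γ K := (w i)⁻¹ • w
  have huL : u ∈ L := L.smul_mem _ hw
  have hui : u i = 1 := by simp [u, hi]
  have huJ : ∀ j ∈ J, u j = 0 := fun j hj => by simp [u, hwJ j hj]
  have huX : ∀ k, X k ≤ (u k).orderTop + X i := by
    intro k
    have h1 : w k = w i * u k := by simp [u, hi]
    have h2 := hpiv k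
    rw [h1, HahnSeries.orderTop_mul, add_comm, add_assoc] at h2
    exact (WithTop.add_le_add_iff_left (HahnSeries.orderTop_ne_top.mpr hi)).mp h2
  have hmem : insert i J ∈ P := by
    refine ⟨fun j => if j = i then u else v j - v j i • u, ?_, ?_, ?_⟩
    · intro j hj
      by_cases hji : j = i
      · simp [hji, huL]
      · have hjJ : j ∈ J := by simpa [hji] using hj
        simp only [hji, if_false]
        exact L.sub_mem (hL j hjJ) (L.smul_mem _ huL)
    · intro j hj k hk
      by_cases hji : j = i
      · subst hji
        by_cases hkj : k = j
        · simp [hkj, hui]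
        · have hkJ : k ∈ J := by simpa [hkj] using hk
          simp [hkj, huJ k hkJ]
      · have hjJ : j ∈ J := by simpa [hji] using hj
        by_cases hki : k = i
        · subst hki
          simp [hji, hui, Ne.symm hji]
        · have hkJ : k ∈ J := by simpa [hki] using hk
          simp [hji, huJ k hkJ, hd j hjJ k hkJ]
    · intro j hj k
      by_cases hji : j = i
      · subst hji
        simpa using huX k
      · have hjJ : j ∈ J := by simpa [hji] using hj
        simp only [hji, if_false, Pi.sub_apply, Pi.smul_apply, smul_eq_mul]
        have h1 := hX j hjJ k
        have h2 : X k ≤ (v j i * u k).orderTop + X j := by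
          rw [HahnSeries.orderTop_mul]
          calc X k ≤ (u k).orderTop + X i := huX k
            _ ≤ (u k).orderTop + ((v j i).orderTop + X j) := by
              gcongr; exact hX j hjJ i
            _ = _ := by rw [← add_assoc, add_comm (u k).orderTop]
        have h3 := HahnSeries.min_orderTop_le_orderTop_sub (x := v j k) (y := v j i * u k)
        rcases min_le_iff.mp h3 with h | h
        · exact h1.trans (by gcongr)
        · exact h2.trans (by gcongr)
  exact hiJ (hmax hmem (Finset.subset_insert i J) (Finset.mem_insert_self i J))

/-- Let `K` be an infinite field and `L ⊆ K((Γ))^E` a linear subspace. A pair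
`(a, X)` with `a_i = 0 ↔ X_i = ∞` lies in the coordinatewise fine valuation image of `L`
(recording leading coefficients and leading powers) iff for every circuit `c` of `L^⊥` the sum
`∑_{i∈S} a_i · lc(c_i)` vanishes, where `S` is the set of indices where `X_i + val(c_i)` is
finite and minimal. -/
theorem fval_image_of_linear_space
    {K : Type*} [Field K] [Infinite K] {Γ : Type*} [AddCommGroup Γ] [LinearOrder Γ] [IsOrderedAddMonoid Γ]
    {E : Type*} [Fintype E]
    (L : Submodule (HahnSeries Γ K) (E → HahnSeries Γ K))
    (a : E → K) (X : E → WithTop Γ)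
    (haX : ∀ i : E, a i = 0 ↔ X i = ⊤) :
    (∃ x ∈ L, ∀ i : E, (x i).leadingCoeff = a i ∧ (x i).orderTop = X i) ↔
      ∀ c : E → HahnSeries Γ K, IsCircuitOf (perpSet (L : Set (E → HahnSeries Γ K))) c →
        ∑ i ∈ Finset.univ.filter (fun i : E =>
            X i + (c i).orderTop ≠ ⊤ ∧
            ∀ j : E, X i + (c i).orderTop ≤ X j + (c j).orderTop),
          a i * (c i).leadingCoeff = 0 := by
  constructor
  · rintro ⟨x, hx, hxa⟩ c ⟨hc, -, -⟩
    have key : ∀ i, X i + (c i).orderTop = (x i * c i).orderTop := fun i => by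
      rw [HahnSeries.orderTop_mul, (hxa i).2]
    have key2 : ∀ i, a i * (c i).leadingCoeff = (x i * c i).leadingCoeff := fun i => by
      rw [HahnSeries.leadingCoeff_mul, (hxa i).1]
    simp only [key, key2]
    by_cases hE : ∃ i0, (x i0 * c i0).orderTop ≠ ⊤ ∧
        ∀ j, (x i0 * c i0).orderTop ≤ (x j * c j).orderTop
    · obtain ⟨i0, h0, hm⟩ := hE
      obtain ⟨g, hg⟩ := WithTop.ne_top_iff_exists.mp h0
      rw [← fv_sum_coeff (fun i => x i * c i) g i0 hg.symm (fun j => hg ▸ hm j), hc x hx]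
      simp
    · rw [Finset.filter_false_of_mem (fun i _ h => hE ⟨i, h⟩)]
      simp
  · intro H
    obtain ⟨J, v, hL, hd, hX, hz⟩ := fv_basis L X
    have hrep : ∀ x ∈ L, x = ∑ j ∈ J, x j • v j := by
      intro x hx
      rw [← sub_eq_zero]
      refine hz _ (L.sub_mem hx (L.sum_mem fun j hj => L.smul_mem _ (hL j hj))) fun k hk => ?_
      simp only [Pi.sub_apply, Finset.sum_apply, Pi.smul_apply, smul_eq_mul]
      rw [Finset.sum_congr rfl (fun j hj => by rw [hd j hj k hk])]
      simp [hk]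
    let T : E → HahnSeries Γ K := fun i => HahnSeries.single ((X i).untopD 0) (a i)
    have hTl : ∀ i, (T i).leadingCoeff = a i := fun i => by simp [T]
    have hTo : ∀ i, (T i).orderTop = X i := fun i => by
      by_cases h : X i = ⊤
      · simp [T, (haX i).2 h, h]
      · simp only [T]
        rw [HahnSeries.orderTop_single (fun h' => h ((haX i).1 h'))]
        obtain ⟨g, hg⟩ := WithTop.ne_top_iff_exists.mp h
        simp [← hg]
    let x : E → HahnSeries Γ K := ∑ j ∈ J, T j • v j
    have hxi : ∀ i, x i = ∑ j ∈ J, T j * v j i := fun i => by simp [x]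
    refine ⟨x, L.sum_mem fun j hj => L.smul_mem _ (hL j hj), fun i => ?_⟩
    by_cases hiJ : i ∈ J
    · have : x i = T i := by
        rw [hxi, Finset.sum_congr rfl (fun j hj => by rw [hd j hj i hiJ])]
        simp [hiJ]
      rw [this]
      exact ⟨hTl i, hTo i⟩
    have hlow : X i ≤ (x i).orderTop := by
      rw [hxi]
      refine fv_le_sum _ _ _ fun j hj => ?_
      rw [HahnSeries.orderTop_mul, hTo, add_comm]
      exact hX j hj i
    by_cases hXi : X i = ⊤
    · rw [hXi, top_le_iff] at hlow
      refine ⟨?_, by rw [hlow, hXi]⟩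
      rw [(haX i).2 hXi]
      simpa using hlow
    obtain ⟨g, hg⟩ := WithTop.ne_top_iff_exists.mp hXi
    let c : E → HahnSeries Γ K := fun k => if k = i then 1 else if k ∈ J then - v k i else 0
    have hci : c i = 1 := by simp [c]
    have hcJ : ∀ j ∈ J, c j = - v j i := fun j hj => by
      have : j ≠ i := fun h => hiJ (h ▸ hj)
      simp [c, this, hj]
    have hc0 : ∀ k, k ≠ i → k ∉ J → c k = 0 := fun k h1 h2 => by simp [c, h1, h2]
    -- sums against vectors supported on `insert i J`
    have hsum : ∀ (y : E → HahnSeries Γ K), ∑ k, y k * c k = y i - ∑ j ∈ J, y j * v j i := by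
      intro y
      rw [← Finset.sum_subset (Finset.subset_univ (insert i J)), Finset.sum_insert hiJ, hci,
        Finset.sum_congr rfl (fun j hj => by rw [hcJ j hj])]
      · simp [sub_eq_add_neg]
      · intro k _ hk
        rw [Finset.mem_insert, not_or] at hk
        rw [hc0 k hk.1 hk.2, mul_zero]
    have hcirc : IsCircuitOf (perpSet (L : Set (E → HahnSeries Γ K))) c := by
      refine ⟨?_, ?_, ?_⟩
      · intro y hy
        rw [hsum, sub_eq_zero]
        conv_lhs => rw [hrep y hy]
        simp
      · intro h
        have := congrFun h i
        rw [hci] at this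
        simp at this
      · intro y hy hy0 hsub
        have hy1 : ∀ k, c k = 0 → y k = 0 := fun k hk => by
          by_contra h
          exact hsub h hk
        have hyc : ∀ k, y k = y i * c k := by
          intro k
          by_cases hki : k = i
          · rw [hki, hci, mul_one]
          by_cases hkJ : k ∈ J
          · have h1 := hy (v k) (hL k hkJ)
            rw [← Finset.sum_subset (Finset.subset_univ (insert i J)),
              Finset.sum_insert hiJ,
              Finset.sum_congr rfl (fun j hj => by rw [hd k hkJ j hj])] at h1
            · simp [hkJ] at h1
              rw [hcJ k hkJ]
              linear_combination h1
            · intro l _ hl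
              rw [Finset.mem_insert, not_or] at hl
              rw [hy1 l (hc0 l hl.1 hl.2), mul_zero]
          · rw [hy1 k (hc0 k hki hkJ), hc0 k hki hkJ, mul_zero]
        have hyi : y i ≠ 0 := by
          intro h
          apply hy0
          funext k
          rw [hyc k, h]
          simp
        ext k
        simp only [Set.mem_setOf_eq]
        rw [hyc k]
        simp [hyi]
    have h1 := H c hcirc
    have key : ∀ i, X i + (c i).orderTop = (T i * c i).orderTop := fun i => by
      rw [HahnSeries.orderTop_mul, hTo]
    have key2 : ∀ i, a i * (c i).leadingCoeff = (T i * c i).leadingCoeff := fun i => by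
      rw [HahnSeries.leadingCoeff_mul, hTl]
    simp only [key, key2] at h1
    rw [← fv_sum_coeff (fun i => T i * c i) g i (by simp [hci, hTo, hg]), hsum, ← hxi] at h1
    · have h2 : (T i).coeff g = a i := by
        rw [fv_coeff_le _ _ (by rw [hTo, hg]), hTo, hg, if_pos rfl, hTl]
      have h3 : (x i).coeff g = a i := by
        rw [HahnSeries.coeff_sub, h2] at h1
        exact (sub_eq_zero.mp h1).symm
      have h4 : (x i).orderTop = X i := by
        refine le_antisymm ?_ hlow
        rw [← hg]
        refine HahnSeries.orderTop_le_of_coeff_ne_zero ?_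
        rw [h3]
        exact fun h => hXi ((haX i).1 h)
      refine ⟨?_, h4⟩
      rw [← h3, fv_coeff_le _ _ (by rw [h4, hg]), h4, hg, if_pos rfl]
    · intro k
      rw [← key, hg]
      by_cases hki : k = i
      · rw [hki, hci]; simp
      by_cases hkJ : k ∈ J
      · rw [hcJ k hkJ, HahnSeries.orderTop_neg, add_comm]
        exact hX k hkJ i
      · rw [hc0 k hki hkJ]; simp
end
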